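/- Consider bond percolation on Z^d (d ≥ 3) with p < p_c. Then almost surely there exists an infinite open surface in the dual plaquette process; consequently p_surf ≥ p_c, where p_surf is the critical value for existence of infinite open dual surfaces. -/

import Mathlib

open Set Relation Filter

/-- Vertices of the lattice `ℤ^d`. -/
abbrev V (d : ℕ) := Fin d → ℤ

/-- Nearest-neighbour adjacency in `ℤ^d`: `x` and `y` differ by `1` in exactly
one coordinate. -/
def latAdj {d : ℕ} (x y : V d) : Prop :=
  ∃ i, (x i - y i).natAbs = 1 ∧ ∀ j, j ≠ i → x j = y j

/-- Connectivity in the complement of `S` (paths avoiding `S`). -/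
def connAvoid {d : ℕ} (S : Set (V d)) (a b : V d) : Prop :=
  ReflTransGen (fun u v => latAdj u v ∧ u ∉ S ∧ v ∉ S) a b

/-- The connected component of `w` in the complement of `S`. -/
def compOff {d : ℕ} (S : Set (V d)) (w : V d) : Set (V d) :=
  {z | connAvoid S w z}

/-- `y` lies outside `S` and is joined to infinity off `S` (its component in
the complement of `S` is infinite). -/
def toInfOff {d : ℕ} (S : Set (V d)) (y : V d) : Prop :=
  y ∉ S ∧ (compOff S y).Infinite

/-- `S ⊆ ℤ^d` is connected (as an induced subgraph of the lattice). -/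
def IsLatConnected {d : ℕ} (S : Set (V d)) : Prop :=
  ∀ a ∈ S, ∀ b ∈ S, ReflTransGen (fun u v => latAdj u v ∧ u ∈ S ∧ v ∈ S) a b

/-- `S` together with all its holes (the finite components of its complement). -/
def fillHoles {d : ℕ} (S : Set (V d)) : Set (V d) :=
  S ∪ {w | w ∉ S ∧ (compOff S w).Finite}

/-- We identify a plaquette with its dual edge, realized as an unordered pair of
adjacent lattice points.  `PiS S` is the set of plaquettes dual to edges
`⟨x,y⟩` with `x ∈ S` and `y ∉ S` joined to infinity off `S`. -/
def PiS {d : ℕ} (S : Set (V d)) : Set (Sym2 (V d)) :=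
  {e | ∃ x y, latAdj x y ∧ x ∈ S ∧ toInfOff S y ∧ e = s(x, y)}

/-- The `i`-th unit coordinate vector. -/
def uv {d : ℕ} (i : Fin d) : V d := fun k => if k = i then 1 else 0

/-- A unit square (2-facet) of `ℤ^d`; its dual is a `(d-2)`-facet of the dual
lattice `ℤ^d + (1/2,…,1/2)`. -/
structure Square (d : ℕ) where
  corner : V d
  i : Fin d
  j : Fin d
  hij : i ≠ j

/-- The four edges of a unit square.  A plaquette (identified with its dual
edge `e`) is incident to the `(d-2)`-facet dual to the square `F` exactly when
`e` is one of the four edges of `F`. -/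
def edgesOf {d : ℕ} (F : Square d) : Set (Sym2 (V d)) :=
  {s(F.corner, F.corner + uv F.i), s(F.corner, F.corner + uv F.j),
   s(F.corner + uv F.i, F.corner + uv F.i + uv F.j),
   s(F.corner + uv F.j, F.corner + uv F.i + uv F.j)}

/-- A set of plaquettes has empty boundary if every `(d-2)`-facet of the dual
lattice is incident to an even number of its members. -/
def NoBoundary {d : ℕ} (P : Set (Sym2 (V d))) : Prop :=
  ∀ F : Square d, Even (edgesOf F ∩ P).ncard

/-- Two plaquettes are adjacent if their intersection is a `(d-2)`-facet,
equivalently their dual edges are distinct edges of a common unit square. -/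
def plaqAdj {d : ℕ} (e₁ e₂ : Sym2 (V d)) : Prop :=
  e₁ ≠ e₂ ∧ ∃ F : Square d, e₁ ∈ edgesOf F ∧ e₂ ∈ edgesOf F

/-- A set of plaquettes is connected for the adjacency relation `plaqAdj`. -/
def PlaqConnected {d : ℕ} (P : Set (Sym2 (V d))) : Prop :=
  ∀ a ∈ P, ∀ b ∈ P, ReflTransGen (fun u v => plaqAdj u v ∧ u ∈ P ∧ v ∈ P) a b

open MeasureTheory

/-- A bond percolation configuration on `ℤ^d`: a state in `{0,1}` for each
unordered pair of vertices (only the values on edges are relevant). -/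
abbrev Config (d : ℕ) := Sym2 (V d) → Bool

/-- `e` is an edge of the lattice `ℤ^d`. -/
def IsEdge {d : ℕ} (e : Sym2 (V d)) : Prop :=
  ∃ x y, latAdj x y ∧ e = s(x, y)

/-- `x` and `y` are joined by an open path in the configuration `ω`. -/
def openConn {d : ℕ} (ω : Config d) (x y : V d) : Prop :=
  ReflTransGen (fun a b => latAdj a b ∧ ω s(a, b) = true) x y

/-- The open cluster of `x`. -/
def cluster {d : ℕ} (ω : Config d) (x : V d) : Set (V d) :=
  {y | openConn ω x y}

/-- `x` lies in an infinite open cluster (equivalently, `x ↔ ∞`). -/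
def inInfCluster {d : ℕ} (ω : Config d) (x : V d) : Prop :=
  (cluster ω x).Infinite

/-- The set `X` of vertices lying in no infinite open cluster. -/
def Xset {d : ℕ} (ω : Config d) : Set (V d) := {x | ¬ inInfCluster ω x}

/-- The connected component of `x` in the graph induced on `X` by the lattice. -/
def XComp {d : ℕ} (ω : Config d) (x : V d) : Set (V d) :=
  {y | ReflTransGen (fun a b => latAdj a b ∧ a ∈ Xset ω ∧ b ∈ Xset ω) x y}

/-- The event that `X` has an infinite connected component. -/
def XhasInf {d : ℕ} (ω : Config d) : Prop :=
  ∃ x ∈ Xset ω, (XComp ω x).Infinite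

/-- `P` is the law of i.i.d. Bernoulli(`p`) bond percolation: cylinder events
determined by finitely many edges have the product probability. -/
def IsBernoulli {d : ℕ} (P : Measure (Config d)) (p : ℝ) : Prop :=
  ∀ s : Finset (Sym2 (V d)), (∀ e ∈ s, IsEdge e) → ∀ f : Sym2 (V d) → Bool,
    P {ω | ∀ e ∈ s, ω e = f e} =
      ∏ e ∈ s, ENNReal.ofReal (if f e then p else 1 - p)

/-- The critical probability `p_c` of bond percolation on `ℤ^d`:
the supremum of the parameters for which there is a.s. no infinite cluster. -/
noncomputable def pc (d : ℕ) : ℝ :=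
  sSup {p | p ∈ Set.Icc (0 : ℝ) 1 ∧ ∀ P : Measure (Config d),
    IsBernoulli P p → IsProbabilityMeasure P →
      P {ω | ∃ x, inInfCluster ω x} = 0}

/-- The critical value `p_fin`: the supremum of the parameters for which `X`,
the union of the finite open clusters, has an infinite component with positive
probability. -/
noncomputable def pfin (d : ℕ) : ℝ :=
  sSup {p | p ∈ Set.Icc (0 : ℝ) 1 ∧ ∀ P : Measure (Config d),
    IsBernoulli P p → IsProbabilityMeasure P →
      P {ω | XhasInf ω} ≠ 0}

/-- A plaquette (identified with its dual edge) is open iff its dual edge is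
closed.  `InfOpenSurface ω` asserts the existence of an infinite open surface:
an infinite connected set of open plaquettes with empty boundary. -/
def InfOpenSurface {d : ℕ} (ω : Config d) : Prop :=
  ∃ S : Set (Sym2 (V d)), S.Infinite ∧
    (∀ e ∈ S, IsEdge e ∧ ω e = false) ∧
    PlaqConnected S ∧ NoBoundary S

/-- The critical value `p_surf`: the supremum of the parameters for which an
infinite open surface of dual plaquettes exists with positive probability. -/
noncomputable def psurf (d : ℕ) : ℝ :=
  sSup {p | p ∈ Set.Icc (0 : ℝ) 1 ∧ ∀ P : Measure (Config d),
    IsBernoulli P p → IsProbabilityMeasure P →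
      P {ω | InfOpenSurface ω} ≠ 0}

/-! ### Finite Bernoulli product weights -/

section FiniteBernoulli

variable {ι : Type*}

/-- The event `A` is determined by the states of the elements of `s`. -/
def DependsOnSet (A : Set ι → Prop) (s : Set ι) : Prop :=
  ∀ T : Set ι, A T ↔ A (T ∩ s)

theorem DependsOnSet.mono {A : Set ι → Prop} {s t : Set ι} (h : DependsOnSet A s)
    (hst : s ⊆ t) : DependsOnSet A t := fun T => by
  rw [h T, h (T ∩ t), inter_assoc, inter_eq_self_of_subset_right hst]

theorem DependsOnSet.and {A B : Set ι → Prop} {s t : Set ι} (hA : DependsOnSet A s)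
    (hB : DependsOnSet B t) : DependsOnSet (fun T => A T ∧ B T) (s ∪ t) := fun T =>
  and_congr (hA.mono subset_union_left T) (hB.mono subset_union_right T)

theorem DependsOnSet.comp_insert {A : Set ι → Prop} {s : Set ι} (h : DependsOnSet A s) (e : ι) :
    DependsOnSet (fun T => A (insert e T)) s := fun T => by
  change A (insert e T) ↔ A (insert e (T ∩ s))
  rw [h (insert e T), h (insert e (T ∩ s))]
  congr! 1
  ext x; simp only [mem_inter_iff, mem_insert_iff]; tauto

theorem DependsOnSet.comp_diff {A : Set ι → Prop} {s : Set ι} (h : DependsOnSet A s) (e : ι) :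
    DependsOnSet (fun T => A (T \ {e})) s := fun T => by
  change A (T \ {e}) ↔ A ((T ∩ s) \ {e})
  rw [h (T \ {e}), h ((T ∩ s) \ {e})]
  congr! 1
  ext x; simp only [mem_inter_iff, Set.mem_sdiff, mem_singleton_iff]; tauto

theorem DependsOnSet.insert_iff {A : Set ι → Prop} {s : Set ι} (h : DependsOnSet A s) {e : ι}
    (he : e ∉ s) (T : Set ι) : A (insert e T) ↔ A T := by
  rw [h (insert e T), h T, insert_inter_of_notMem he]

theorem DependsOnSet.diff_iff {A : Set ι → Prop} {s : Set ι} (h : DependsOnSet A s) {e : ι}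
    (he : e ∉ s) (T : Set ι) : A (T \ {e}) ↔ A T := by
  rw [h (T \ {e}), h T]
  congr! 1
  ext x; simp only [mem_inter_iff, Set.mem_sdiff, mem_singleton_iff]
  grind

variable [DecidableEq ι]

open scoped Classical in
/-- The probability of the event `A` when each element of `s` is open independently with
probability `p` and all other elements are closed. -/
noncomputable def bernProb (p : ℝ) (s : Finset ι) (A : Set ι → Prop) : ℝ :=
  ∑ T ∈ s.powerset, (if A (T : Set ι) then 1 else 0) * ∏ e ∈ s, (if e ∈ T then p else 1 - p)

theorem bernProb_congr {p : ℝ} {s : Finset ι} {A B : Set ι → Prop} (h : ∀ T, A T ↔ B T) :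
    bernProb p s A = bernProb p s B := by
  have : A = B := funext fun T => propext (h T)
  rw [this]

theorem bernProb_empty (p : ℝ) (A : Set ι → Prop) [Decidable (A ∅)] :
    bernProb p ∅ A = if A ∅ then 1 else 0 := by
  rw [bernProb, Finset.powerset_empty, Finset.sum_singleton, Finset.prod_empty, mul_one,
    Finset.coe_empty]
  congr

theorem bernProb_insert (p : ℝ) {s : Finset ι} {e : ι} (he : e ∉ s) (A : Set ι → Prop) :
    bernProb p (insert e s) A = p * bernProb p s (fun T => A (insert e T)) +
      (1 - p) * bernProb p s (fun T => A (T \ {e})) := by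
  unfold bernProb
  rw [Finset.sum_powerset_insert he, Finset.mul_sum, Finset.mul_sum, add_comm]
  congr 1
  · refine Finset.sum_congr rfl fun T hT => ?_
    have hT' := Finset.mem_powerset.1 hT
    rw [Finset.prod_insert he, if_pos (Finset.mem_insert_self e T), Finset.coe_insert]
    rw [Finset.prod_congr rfl (g := fun x => if x ∈ T then p else 1 - p)]
    · ring
    · intro x hx
      have : x ≠ e := fun h => he (h ▸ hx)
      simp [this]
  · refine Finset.sum_congr rfl fun T hT => ?_
    have hT' := Finset.mem_powerset.1 hT
    have heT : e ∉ T := fun h => he (hT' h)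
    have hd : A ((T : Set ι) \ {e}) ↔ A T := by rw [sdiff_singleton_eq_self heT]
    rw [Finset.prod_insert he, if_neg heT]
    by_cases h : A T
    · rw [if_pos h, if_pos (hd.2 h)]
      ring
    · rw [if_neg h, if_neg (mt hd.1 h)]
      ring

theorem bernProb_true (p : ℝ) (s : Finset ι) : bernProb p s (fun _ => True) = 1 := by
  induction s using Finset.induction_on with
  | empty => simp [bernProb]
  | insert e s he ih => rw [bernProb_insert p he, ih]; ring

/-- Domination of expected counts by pointwise domination of counts. -/
theorem sum_bernProb_le {p : ℝ} (hp : p ∈ Icc (0 : ℝ) 1) (s : Finset ι) {α β : Type*}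
    (I : Finset α) (J : Finset β) (A : α → Set ι → Prop) (B : β → Set ι → Prop)
    (h : ∀ T : Set ι, ∀ I' ⊆ I, (∀ i ∈ I', A i T) →
      ∃ J' ⊆ J, (∀ j ∈ J', B j T) ∧ I'.card ≤ J'.card) :
    ∑ i ∈ I, bernProb p s (A i) ≤ ∑ j ∈ J, bernProb p s (B j) := by
  classical
  unfold bernProb
  rw [Finset.sum_comm, Finset.sum_comm (s := J)]
  refine Finset.sum_le_sum fun T _ => ?_
  rw [← Finset.sum_mul, ← Finset.sum_mul]
  refine mul_le_mul_of_nonneg_right ?_ (Finset.prod_nonneg fun e _ => ?_)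
  · rw [Finset.sum_boole, Finset.sum_boole]
    obtain ⟨J', hJ, hB, hc⟩ := h T (I.filter fun i => A i T) (Finset.filter_subset _ _)
      (fun i hi => (Finset.mem_filter.1 hi).2)
    exact_mod_cast hc.trans (Finset.card_le_card fun j hj =>
      Finset.mem_filter.2 ⟨hJ hj, hB j hj⟩)
  · split_ifs
    · exact hp.1
    · linarith [hp.2]

theorem sum_bernProb_le_of_injOn {p : ℝ} (hp : p ∈ Icc (0 : ℝ) 1) (s : Finset ι) {α β : Type*}
    (I : Finset α) (J : Finset β) (A : α → Set ι → Prop) (B : β → Set ι → Prop) (f : α → β)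
    (hf : ∀ T, ∀ i ∈ I, A i T → f i ∈ J ∧ B (f i) T)
    (hinj : ∀ T, ∀ i ∈ I, ∀ i' ∈ I, A i T → A i' T → f i = f i' → i = i') :
    ∑ i ∈ I, bernProb p s (A i) ≤ ∑ j ∈ J, bernProb p s (B j) := by
  classical
  refine sum_bernProb_le hp s I J A B fun T I' hI hA => ⟨I'.image f, ?_, ?_, ?_⟩
  · exact Finset.image_subset_iff.2 fun i hi => (hf T i (hI hi) (hA i hi)).1
  · intro j hj
    obtain ⟨i, hi, rfl⟩ := Finset.mem_image.1 hj
    exact (hf T i (hI hi) (hA i hi)).2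
  · rw [Finset.card_image_of_injOn]
    exact fun i hi i' hi' h => hinj T i (hI hi) i' (hI hi') (hA i hi) (hA i' hi') h

theorem bernProb_le_sum {p : ℝ} (hp : p ∈ Icc (0 : ℝ) 1) (s : Finset ι) {β : Type*}
    (J : Finset β) (A : Set ι → Prop) (B : β → Set ι → Prop)
    (h : ∀ T, A T → ∃ j ∈ J, B j T) :
    bernProb p s A ≤ ∑ j ∈ J, bernProb p s (B j) := by
  classical
  have := sum_bernProb_le hp s (Finset.univ : Finset Unit) J (fun _ => A) B ?_
  · simpa using this
  · intro T I' _ hA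
    rcases I'.eq_empty_or_nonempty with rfl | ⟨i, hi⟩
    · exact ⟨∅, by simp⟩
    · obtain ⟨j, hj, hB⟩ := h T (hA i hi)
      refine ⟨{j}, by simpa using hj, by simpa using hB, ?_⟩
      simpa using Finset.card_le_univ I'

theorem bernProb_mono {p : ℝ} (hp : p ∈ Icc (0 : ℝ) 1) (s : Finset ι) {A B : Set ι → Prop}
    (h : ∀ T, A T → B T) : bernProb p s A ≤ bernProb p s B := by
  simpa using bernProb_le_sum hp s (Finset.univ : Finset Unit) A (fun _ => B)
    (fun T hT => ⟨(), by simp, h T hT⟩)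

theorem bernProb_nonneg {p : ℝ} (hp : p ∈ Icc (0 : ℝ) 1) (s : Finset ι) (A : Set ι → Prop) :
    0 ≤ bernProb p s A := by
  simpa using sum_bernProb_le_of_injOn hp s (∅ : Finset Unit) (Finset.univ : Finset Unit)
    (fun _ => A) (fun _ => A) id (by simp) (by simp)

theorem bernProb_le_one {p : ℝ} (hp : p ∈ Icc (0 : ℝ) 1) (s : Finset ι) (A : Set ι → Prop) :
    bernProb p s A ≤ 1 :=
  (bernProb_mono hp s fun _ _ => trivial).trans_eq (bernProb_true p s)

theorem bernProb_compl (p : ℝ) (s : Finset ι) (A : Set ι → Prop) :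
    bernProb p s (fun T => ¬ A T) = 1 - bernProb p s A := by
  rw [← bernProb_true p s]
  unfold bernProb
  rw [← Finset.sum_sub_distrib]
  refine Finset.sum_congr rfl fun T _ => ?_
  by_cases h : A T <;> simp [h]

theorem bernProb_insert_of_notMem {p : ℝ} {s : Finset ι} {A : Set ι → Prop} {t : Set ι}
    (hA : DependsOnSet A t) {e : ι} (he : e ∉ t) :
    bernProb p (insert e s) A = bernProb p s A := by
  by_cases hes : e ∈ s
  · rw [Finset.insert_eq_self.2 hes]
  · rw [bernProb_insert p hes, bernProb_congr (hA.insert_iff he), bernProb_congr (hA.diff_iff he)]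
    ring

theorem bernProb_eq_of_subset {p : ℝ} {s t : Finset ι} {A : Set ι → Prop}
    (hA : DependsOnSet A s) (hst : s ⊆ t) : bernProb p t A = bernProb p s A := by
  suffices h : ∀ u : Finset ι, Disjoint u s → bernProb p (u ∪ s) A = bernProb p s A by
    rw [← h (t \ s) Finset.sdiff_disjoint, Finset.sdiff_union_of_subset hst]
  intro u
  induction u using Finset.induction_on with
  | empty => simp
  | insert e u he ih =>
    intro hd
    rw [Finset.disjoint_insert_left] at hd
    rw [Finset.insert_union, bernProb_insert_of_notMem hA (by simpa using hd.1), ih hd.2]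

/-- Events depending on disjoint sets are independent. -/
theorem bernProb_and {p : ℝ} (s : Finset ι) {A B : Set ι → Prop} {t u : Set ι}
    (hA : DependsOnSet A t) (hB : DependsOnSet B u) (htu : Disjoint t u) :
    bernProb p s (fun T => A T ∧ B T) = bernProb p s A * bernProb p s B := by
  classical
  induction s using Finset.induction_on generalizing A B with
  | empty =>
    rw [bernProb_empty, bernProb_empty, bernProb_empty]
    by_cases h1 : A ∅ <;> by_cases h2 : B ∅ <;> simp [h1, h2]
  | insert e s he ih =>
    have h1 := ih (hA.comp_insert e) (hB.comp_insert e)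
    have h2 := ih (hA.comp_diff e) (hB.comp_diff e)
    rw [bernProb_insert p he, bernProb_insert p he A, bernProb_insert p he B, h1, h2]
    by_cases het : e ∈ t
    · have heu : e ∉ u := fun h => htu.le_bot ⟨het, h⟩
      rw [bernProb_congr (hB.insert_iff heu), bernProb_congr (hB.diff_iff heu)]
      ring
    · rw [bernProb_congr (hA.insert_iff het), bernProb_congr (hA.diff_iff het)]
      ring

theorem bernProb_mem (p : ℝ) {s : Finset ι} {e : ι} (he : e ∈ s) :
    bernProb p s (fun T => e ∈ T) = p := by
  have hA : DependsOnSet (fun T : Set ι => e ∈ T) (({e} : Finset ι) : Set ι) := fun T => by simp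
  rw [bernProb_eq_of_subset hA (Finset.singleton_subset_iff.2 he),
    ← insert_empty_eq, bernProb_insert p (Finset.notMem_empty e)]
  classical
  rw [bernProb_empty, bernProb_empty]
  simp

theorem bernProb_image {κ : Type*} [DecidableEq κ] (p : ℝ) (f : ι → κ)
    (hf : Function.Injective f) (s : Finset ι) (A : Set κ → Prop) :
    bernProb p (s.image f) A = bernProb p s (fun T => A (f '' T)) := by
  classical
  induction s using Finset.induction_on generalizing A with
  | empty => rw [Finset.image_empty, bernProb_empty, bernProb_empty]; simp
  | insert e s he ih =>
    rw [Finset.image_insert, bernProb_insert p (by simpa [hf.eq_iff] using he), ih, ih,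
      bernProb_insert p he]
    simp only [image_insert_eq, image_sdiff hf, image_singleton]

/-- A lower bound form of Russo's formula. -/
theorem exists_hasDerivAt_bernProb {p : ℝ} (hp : p ∈ Icc (0 : ℝ) 1) (s : Finset ι)
    {A : Set ι → Prop} (hA : ∀ T U : Set ι, T ⊆ U → A T → A U) :
    ∃ D, HasDerivAt (fun q => bernProb q s A) D p ∧
      ∑ e ∈ s, bernProb p s (fun T => ¬ A T ∧ A (insert e T)) ≤ D := by
  classical
  induction s using Finset.induction_on generalizing A with
  | empty =>
    refine ⟨0, ?_, by simp⟩
    simp only [bernProb_empty]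
    exact hasDerivAt_const _ _
  | insert e s he ih =>
    obtain ⟨D₁, hD₁, h₁⟩ := ih (A := fun T => A (insert e T))
      (fun T U h => hA _ _ (insert_subset_insert h))
    obtain ⟨D₂, hD₂, h₂⟩ := ih (A := fun T => A (T \ {e}))
      (fun T U h => hA _ _ (sdiff_subset_sdiff_left h))
    refine ⟨1 * bernProb p s (fun T => A (insert e T)) + p * D₁ +
      ((-1) * bernProb p s (fun T => A (T \ {e})) + (1 - p) * D₂), ?_, ?_⟩
    · have : (fun q => bernProb q (insert e s) A) = fun q =>
          q * bernProb q s (fun T => A (insert e T)) +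
          (1 - q) * bernProb q s (fun T => A (T \ {e})) := by
        funext q; exact bernProb_insert q he A
      rw [this]
      exact ((hasDerivAt_id p).mul hD₁).add (((hasDerivAt_id p).const_sub 1).mul hD₂)
    · have hdiff : bernProb p s (fun T => ¬ A (T \ {e}) ∧ A (insert e T)) =
          bernProb p s (fun T => A (insert e T)) - bernProb p s (fun T => A (T \ {e})) := by
        unfold bernProb
        rw [← Finset.sum_sub_distrib]
        refine Finset.sum_congr rfl fun T _ => ?_
        have := hA ((T : Set ι) \ {e}) (insert e (T : Set ι))
          (sdiff_subset.trans (subset_insert _ _))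
        by_cases h1 : A ((T : Set ι) \ {e}) <;> by_cases h2 : A (insert e (T : Set ι)) <;>
          simp_all
      rw [Finset.sum_insert he]
      have hfirst : bernProb p (insert e s) (fun T => ¬ A T ∧ A (insert e T)) ≤
          bernProb p s (fun T => A (insert e T)) - bernProb p s (fun T => A (T \ {e})) := by
        rw [bernProb_insert p he, ← hdiff]
        simp only [insert_idem, not_and_self_iff, insert_sdiff_singleton]
        have h0 : bernProb p s (fun _ => False) = 0 := by simp [bernProb]
        rw [h0]
        have := bernProb_nonneg hp s (fun T => ¬ A (T \ {e}) ∧ A (insert e T))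
        nlinarith [hp.1, hp.2]
      have hrest : ∑ x ∈ s, bernProb p (insert e s) (fun T => ¬ A T ∧ A (insert x T)) =
          p * ∑ x ∈ s, bernProb p s (fun T => ¬ A (insert e T) ∧ A (insert e (insert x T))) +
          (1 - p) * ∑ x ∈ s, bernProb p s
            (fun T => ¬ A (T \ {e}) ∧ A ((insert x T) \ {e})) := by
        rw [Finset.mul_sum, Finset.mul_sum, ← Finset.sum_add_distrib]
        refine Finset.sum_congr rfl fun x hx => ?_
        have hxe : x ≠ e := fun h => he (h ▸ hx)
        rw [bernProb_insert p he]
        congr 2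
        · refine bernProb_congr fun T => ?_
          rw [insert_comm]
        · refine bernProb_congr fun T => ?_
          rw [insert_sdiff_of_notMem _ (by simpa using hxe)]
      rw [hrest]
      have h3 := mul_le_mul_of_nonneg_left h₁ hp.1
      have h4 := mul_le_mul_of_nonneg_left h₂ (sub_nonneg.2 hp.2)
      linarith

theorem bernProb_monotoneOn (s : Finset ι) {A : Set ι → Prop}
    (hA : ∀ T U : Set ι, T ⊆ U → A T → A U) :
    MonotoneOn (fun q => bernProb q s A) (Icc 0 1) := by
  have key : ∀ p ∈ Icc (0 : ℝ) 1, ∃ D, HasDerivAt (fun q => bernProb q s A) D p ∧ 0 ≤ D :=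
    fun p hp => by
      obtain ⟨D, hD, h⟩ := exists_hasDerivAt_bernProb hp s hA
      exact ⟨D, hD, (Finset.sum_nonneg fun e _ => bernProb_nonneg hp s _).trans h⟩
  refine monotoneOn_of_deriv_nonneg (convex_Icc 0 1) ?_ ?_ ?_
  · intro p hp
    obtain ⟨D, hD, -⟩ := key p hp
    exact hD.continuousAt.continuousWithinAt
  · intro p hp
    obtain ⟨D, hD, -⟩ := key p (interior_subset hp)
    exact hD.differentiableAt.differentiableWithinAt
  · intro p hp
    obtain ⟨D, hD, h⟩ := key p (interior_subset hp)
    rwa [hD.deriv]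

end FiniteBernoulli

/-! ### Lattice geometry and restricted connectivity -/

section Lattice

variable {d : ℕ}

theorem latAdj_symm {x y : V d} (h : latAdj x y) : latAdj y x := by
  obtain ⟨i, hi, h⟩ := h
  exact ⟨i, by omega, fun j hj => (h j hj).symm⟩

theorem isEdge_mk {x y : V d} : IsEdge s(x, y) ↔ latAdj x y := by
  refine ⟨?_, fun h => ⟨x, y, h, rfl⟩⟩
  rintro ⟨a, b, hab, h⟩
  rcases Sym2.eq_iff.1 h with ⟨rfl, rfl⟩ | ⟨rfl, rfl⟩
  · exact hab
  · exact latAdj_symm hab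

/-- The `ℓ^∞` distance on `ℤ^d`. -/
def supDist (x y : V d) : ℕ := Finset.univ.sup fun i => (x i - y i).natAbs

theorem supDist_le_iff {x y : V d} {n : ℕ} :
    supDist x y ≤ n ↔ ∀ i, (x i - y i).natAbs ≤ n := by
  simp [supDist]

theorem natAbs_sub_le_supDist (x y : V d) (i : Fin d) : (x i - y i).natAbs ≤ supDist x y :=
  supDist_le_iff.1 le_rfl i

theorem supDist_self (x : V d) : supDist x x = 0 := by
  rw [← Nat.le_zero, supDist_le_iff]; simp

theorem supDist_triangle (x y z : V d) : supDist x z ≤ supDist x y + supDist y z := by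
  rw [supDist_le_iff]
  intro i
  have h1 := natAbs_sub_le_supDist x y i
  have h2 := natAbs_sub_le_supDist y z i
  omega

theorem supDist_le_one {x y : V d} (h : latAdj x y) : supDist x y ≤ 1 := by
  obtain ⟨i, hi, h⟩ := h
  rw [supDist_le_iff]
  intro j
  by_cases hj : j = i
  · subst hj; omega
  · have := h j hj; omega

/-- The closed `ℓ^∞` ball of radius `n` about `y`. -/
noncomputable def supBall (y : V d) (n : ℕ) : Finset (V d) :=
  Fintype.piFinset fun i => Finset.Icc (y i - n) (y i + n)

theorem mem_supBall {y z : V d} {n : ℕ} : z ∈ supBall y n ↔ supDist z y ≤ n := by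
  simp only [supBall, Fintype.mem_piFinset, Finset.mem_Icc, supDist_le_iff]
  exact forall_congr' fun i => by omega

/-- `x` and `z` are joined inside `W` by a path whose edges belong to `T`. -/
def joinedIn (T : Set (Sym2 (V d))) (W : Set (V d)) : V d → V d → Prop :=
  ReflTransGen fun a b => latAdj a b ∧ s(a, b) ∈ T ∧ a ∈ W ∧ b ∈ W

theorem joinedIn.symm {T : Set (Sym2 (V d))} {W : Set (V d)} {x z : V d}
    (h : joinedIn T W x z) : joinedIn T W z x := by
  induction h with
  | refl => exact .refl
  | tail _ h ih =>
    exact .head ⟨latAdj_symm h.1, Sym2.eq_swap ▸ h.2.1, h.2.2.2, h.2.2.1⟩ ih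

theorem joinedIn.mono {T T' : Set (Sym2 (V d))} {W W' : Set (V d)} {x z : V d}
    (h : joinedIn T W x z) (hT : T ⊆ T') (hW : W ⊆ W') : joinedIn T' W' x z :=
  ReflTransGen.mono (fun _ _ ⟨h1, h2, h3, h4⟩ => ⟨h1, hT h2, hW h3, hW h4⟩) _ _ h

theorem joinedIn.mem {T : Set (Sym2 (V d))} {W : Set (V d)} {x z : V d}
    (h : joinedIn T W x z) (hx : x ∈ W) : z ∈ W := by
  induction h with
  | refl => exact hx
  | tail _ h _ => exact h.2.2.2

open scoped Classical in
/-- The lattice edges with both endpoints in `W`. -/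
noncomputable def innerEdges (W : Finset (V d)) : Finset (Sym2 (V d)) :=
  W.sym2.filter IsEdge

theorem mk_mem_innerEdges {W : Finset (V d)} {a b : V d} :
    s(a, b) ∈ innerEdges W ↔ a ∈ W ∧ b ∈ W ∧ latAdj a b := by
  simp [innerEdges, isEdge_mk, and_assoc]

theorem isEdge_of_mem_innerEdges {W : Finset (V d)} {e : Sym2 (V d)} (h : e ∈ innerEdges W) :
    IsEdge e := by
  classical
  exact (Finset.mem_filter.1 h).2

theorem mem_of_mem_innerEdges {W : Finset (V d)} {e : Sym2 (V d)} (h : e ∈ innerEdges W)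
    {v : V d} (hv : v ∈ e) : v ∈ W := by
  classical
  exact Finset.mem_sym2_iff.1 (Finset.mem_filter.1 h).1 v hv

theorem innerEdges_mono {W W' : Finset (V d)} (h : W ⊆ W') : innerEdges W ⊆ innerEdges W' := by
  classical
  exact Finset.filter_subset_filter _ (Finset.sym2_mono h)

theorem dependsOnSet_joinedIn (W : Finset (V d)) (x z : V d) :
    DependsOnSet (fun T => joinedIn T (W : Set (V d)) x z) (innerEdges W) := fun _ =>
  ⟨fun h => ReflTransGen.mono (fun _ _ ⟨h1, h2, h3, h4⟩ =>
      ⟨h1, ⟨h2, mk_mem_innerEdges.2 ⟨h3, h4, h1⟩⟩, h3, h4⟩) _ _ h,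
    fun h => h.mono inter_subset_left subset_rfl⟩

theorem DependsOnSet.exists {ι α : Type*} {A : α → Set ι → Prop} {s : Set ι}
    (h : ∀ a, DependsOnSet (A a) s) : DependsOnSet (fun T => ∃ a, A a T) s := fun T =>
  exists_congr fun a => h a T

theorem DependsOnSet.const_and {ι : Type*} {A : Set ι → Prop} {s : Set ι}
    (h : DependsOnSet A s) (P : Prop) : DependsOnSet (fun T => P ∧ A T) s := fun T =>
  and_congr_right fun _ => h T

/-- The vertices joined inside `W` to a vertex of `A`. -/
def clusterIn (T : Set (Sym2 (V d))) (W A : Set (V d)) : Set (V d) :=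
  {z | ∃ a ∈ A, joinedIn T W a z}

theorem subset_clusterIn (T : Set (Sym2 (V d))) (W A : Set (V d)) : A ⊆ clusterIn T W A :=
  fun a ha => ⟨a, ha, .refl⟩

theorem clusterIn_subset {T : Set (Sym2 (V d))} {W A : Set (V d)} (h : A ⊆ W) :
    clusterIn T W A ⊆ W := fun _ ⟨_, ha, hz⟩ => hz.mem (h ha)

theorem clusterIn_mono {T T' : Set (Sym2 (V d))} (W A : Set (V d)) (h : T ⊆ T') :
    clusterIn T W A ⊆ clusterIn T' W A := fun _ ⟨a, ha, hz⟩ => ⟨a, ha, hz.mono h subset_rfl⟩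

theorem mem_clusterIn_of_adj {T : Set (Sym2 (V d))} {W A : Set (V d)} {x y : V d}
    (hx : x ∈ clusterIn T W A) (hxy : latAdj x y) (hT : s(x, y) ∈ T) (hxW : x ∈ W)
    (hyW : y ∈ W) : y ∈ clusterIn T W A := by
  obtain ⟨a, ha, h⟩ := hx
  exact ⟨a, ha, h.tail ⟨hxy, hT, hxW, hyW⟩⟩

open scoped Classical in
/-- The lattice edges inside `W` with at least one endpoint in `C`. -/
noncomputable def touchingEdges (W : Finset (V d)) (C : Set (V d)) : Finset (Sym2 (V d)) :=
  (innerEdges W).filter fun e => ∃ v ∈ C, v ∈ e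

theorem mk_mem_touchingEdges {W : Finset (V d)} {C : Set (V d)} {a b : V d} :
    s(a, b) ∈ touchingEdges W C ↔ (a ∈ W ∧ b ∈ W ∧ latAdj a b) ∧ (a ∈ C ∨ b ∈ C) := by
  classical
  rw [touchingEdges, Finset.mem_filter, mk_mem_innerEdges]
  refine and_congr_right fun _ => ?_
  simp only [Sym2.mem_iff]
  grind

theorem exists_mem_of_mem_touchingEdges {W : Finset (V d)} {C : Set (V d)} {e : Sym2 (V d)}
    (h : e ∈ touchingEdges W C) : ∃ v ∈ C, v ∈ e := by
  classical
  exact (Finset.mem_filter.1 h).2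

theorem clusterIn_eq_of_inter_eq {W : Finset (V d)} {A C : Set (V d)}
    {T T' : Set (Sym2 (V d))} (hT : T ∩ touchingEdges W C = T' ∩ touchingEdges W C)
    (h : clusterIn T W A = C) : clusterIn T' W A = C := by
  apply Subset.antisymm
  · rintro z ⟨a, ha, hz⟩
    induction hz with
    | refl => exact h ▸ subset_clusterIn T _ A ha
    | @tail b c _ hbc hb =>
      obtain ⟨h1, h2, h3, h4⟩ := hbc
      have : s(b, c) ∈ T ∩ touchingEdges W C := by
        rw [hT]
        exact ⟨h2, mk_mem_touchingEdges.2 ⟨⟨h3, h4, h1⟩, .inl hb⟩⟩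
      rw [← h] at hb ⊢
      exact mem_clusterIn_of_adj hb h1 this.1 h3 h4
  · intro z hz
    rw [← h] at hz
    obtain ⟨a, ha, hz⟩ := hz
    induction hz with
    | refl => exact subset_clusterIn T' _ A ha
    | @tail b c hab hbc hb =>
      obtain ⟨h1, h2, h3, h4⟩ := hbc
      have hbC : b ∈ C := h ▸ ⟨a, ha, hab⟩
      have : s(b, c) ∈ T' ∩ touchingEdges W C := by
        rw [← hT]
        exact ⟨h2, mk_mem_touchingEdges.2 ⟨⟨h3, h4, h1⟩, .inl hbC⟩⟩
      exact mem_clusterIn_of_adj hb h1 this.1 h3 h4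

theorem dependsOnSet_clusterIn_eq (W : Finset (V d)) (A C : Set (V d)) :
    DependsOnSet (fun T => clusterIn T W A = C) (touchingEdges W C) := fun T =>
  ⟨clusterIn_eq_of_inter_eq (by rw [inter_assoc, inter_self]),
    clusterIn_eq_of_inter_eq (by rw [inter_assoc, inter_self])⟩

/-- `y` is joined to a vertex at distance at least `n` inside the ball of radius `n`. -/
def reaches (y : V d) (n : ℕ) (T : Set (Sym2 (V d))) : Prop :=
  ∃ z, n ≤ supDist z y ∧ joinedIn T (supBall y n : Set (V d)) y z

theorem reaches_of_joinedIn {T : Set (Sym2 (V d))} {W : Set (V d)} {y z : V d} {n : ℕ}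
    (h : joinedIn T W y z) (hz : n ≤ supDist z y) : reaches y n T := by
  have : reaches y n T ∨ joinedIn T (supBall y n : Set (V d)) y z := by
    clear hz
    induction h with
    | refl => exact .inr .refl
    | @tail b c _ hbc ih =>
      rcases ih with h | h
      · exact .inl h
      · by_cases hb : n ≤ supDist b y
        · exact .inl ⟨b, hb, h⟩
        · refine .inr (h.tail ⟨hbc.1, hbc.2.1, ?_, ?_⟩)
          · exact mem_supBall.2 (by omega)
          · refine mem_supBall.2 ?_
            have h1 := supDist_triangle c b y
            have h2 := supDist_le_one (latAdj_symm hbc.1)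
            omega
  rcases this with h | h
  · exact h
  · exact ⟨z, hz, h⟩

theorem reaches.mono {T T' : Set (Sym2 (V d))} {y : V d} {n : ℕ} (hT : T ⊆ T')
    (h : reaches y n T) : reaches y n T' := by
  obtain ⟨z, hz, h⟩ := h
  exact ⟨z, hz, h.mono hT subset_rfl⟩

theorem reaches.anti {T : Set (Sym2 (V d))} {y : V d} {m n : ℕ} (hmn : m ≤ n)
    (h : reaches y n T) : reaches y m T := by
  obtain ⟨z, hz, h⟩ := h
  exact reaches_of_joinedIn h (hmn.trans hz)

theorem dependsOnSet_reaches (y : V d) (n : ℕ) :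
    DependsOnSet (reaches y n) (innerEdges (supBall y n)) :=
  DependsOnSet.exists fun z => (dependsOnSet_joinedIn _ y z).const_and _

/-- The probability that `y` is joined to distance `n`. -/
noncomputable def reachProb (p : ℝ) (y : V d) (n : ℕ) : ℝ :=
  bernProb p (innerEdges (supBall y n)) (reaches y n)

/-- Translation of edges. -/
def shiftEdge (y : V d) : Sym2 (V d) → Sym2 (V d) := Sym2.map (· + y)

theorem shiftEdge_injective (y : V d) : Function.Injective (shiftEdge y) :=
  Sym2.map.injective (add_left_injective y)

theorem latAdj_add_right {a b y : V d} : latAdj (a + y) (b + y) ↔ latAdj a b := by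
  simp [latAdj]

theorem supDist_add_right (a b y : V d) : supDist (a + y) (b + y) = supDist a b := by
  simp [supDist]

theorem reaches_shift {y : V d} {n : ℕ} {T : Set (Sym2 (V d))} :
    reaches y n (shiftEdge y '' T) ↔ reaches 0 n T := by
  have hball : ∀ a, a + y ∈ supBall y n ↔ a ∈ supBall 0 n := fun a => by
    rw [mem_supBall, mem_supBall, ← supDist_add_right a 0 y, zero_add]
  constructor
  · rintro ⟨z, hz, h⟩
    refine ⟨z - y, ?_, ?_⟩
    · rw [← supDist_add_right _ _ y]; simpa using hz
    · have := ReflTransGen.lift (p := fun a b => latAdj a b ∧ s(a, b) ∈ T ∧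
        a ∈ ((supBall 0 n : Finset (V d)) : Set (V d)) ∧
          b ∈ ((supBall 0 n : Finset (V d)) : Set (V d))) (fun a => a - y) ?_ _ _ h
      · simpa [joinedIn, Function.onFun] using this
      · rintro a b ⟨h1, h2, h3, h4⟩
        refine ⟨?_, ?_, ?_, ?_⟩
        · rw [← latAdj_add_right (y := y)]; simpa using h1
        · have : s(a, b) = shiftEdge y s(a - y, b - y) := by simp [shiftEdge]
          rw [this] at h2
          exact (shiftEdge_injective y).mem_set_image.1 h2
        · exact (hball _).1 (by simpa using h3)
        · exact (hball _).1 (by simpa using h4)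
  · rintro ⟨z, hz, h⟩
    refine ⟨z + y, ?_, ?_⟩
    · rw [← supDist_add_right _ _ y] at hz; simpa using hz
    · have := ReflTransGen.lift (p := fun a b => latAdj a b ∧ s(a, b) ∈ shiftEdge y '' T ∧
        a ∈ (supBall y n : Set (V d)) ∧ b ∈ (supBall y n : Set (V d))) (fun a => a + y) ?_ _ _ h
      · simpa [joinedIn, Function.onFun] using this
      · rintro a b ⟨h1, h2, h3, h4⟩
        exact ⟨latAdj_add_right.2 h1, ⟨_, h2, by simp [shiftEdge]⟩, (hball _).2 h3, (hball _).2 h4⟩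

theorem innerEdges_supBall_eq_image (y : V d) (n : ℕ) :
    innerEdges (supBall y n) = (innerEdges (supBall 0 n)).image (shiftEdge y) := by
  have hball : ∀ a, a ∈ supBall y n ↔ a - y ∈ supBall 0 n := fun a => by
    rw [mem_supBall, mem_supBall, ← supDist_add_right (a - y) 0 y, zero_add, sub_add_cancel]
  ext e
  induction e with
  | _ a b =>
    rw [mk_mem_innerEdges, Finset.mem_image, hball, hball, ← latAdj_add_right (y := -y)]
    constructor
    · intro h
      exact ⟨s(a - y, b - y), mk_mem_innerEdges.2 (by simpa [sub_eq_add_neg] using h),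
        by simp [shiftEdge]⟩
    · rintro ⟨e, he, h⟩
      have : s(a, b) = shiftEdge y s(a - y, b - y) := by simp [shiftEdge]
      rw [this] at h
      rw [shiftEdge_injective y h, mk_mem_innerEdges] at he
      simpa [sub_eq_add_neg] using he

theorem reachProb_eq (p : ℝ) (y : V d) (n : ℕ) :
    reachProb p y n = reachProb p (0 : V d) n := by
  rw [reachProb, innerEdges_supBall_eq_image, bernProb_image p _ (shiftEdge_injective y)]
  exact bernProb_congr fun T => reaches_shift

theorem reachProb_nonneg {p : ℝ} (hp : p ∈ Icc (0 : ℝ) 1) (y : V d) (n : ℕ) :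
    0 ≤ reachProb p y n := bernProb_nonneg hp _ _

theorem reachProb_le_one {p : ℝ} (hp : p ∈ Icc (0 : ℝ) 1) (y : V d) (n : ℕ) :
    reachProb p y n ≤ 1 := bernProb_le_one hp _ _

/-- The oriented edge boundary of `S`. -/
noncomputable def orientedBoundary (S : Finset (V d)) : Finset (V d × V d) := by
  classical
  exact (S ×ˢ S.biUnion fun x => supBall x 1).filter fun q => latAdj q.1 q.2 ∧ q.2 ∉ S

theorem mem_orientedBoundary {S : Finset (V d)} {q : V d × V d} :
    q ∈ orientedBoundary S ↔ q.1 ∈ S ∧ q.2 ∉ S ∧ latAdj q.1 q.2 := by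
  classical
  simp only [orientedBoundary, Finset.mem_filter, Finset.mem_product, Finset.mem_biUnion]
  constructor
  · rintro ⟨⟨h1, -⟩, h2, h3⟩; exact ⟨h1, h3, h2⟩
  · rintro ⟨h1, h2, h3⟩
    exact ⟨⟨h1, q.1, h1, mem_supBall.2 (supDist_le_one (latAdj_symm h3))⟩, h3, h2⟩

/-- The expected number of boundary edges of `S` whose inner endpoint is joined to the origin
inside `S`. -/
noncomputable def exitMean (p : ℝ) (S : Finset (V d)) : ℝ :=
  ∑ q ∈ orientedBoundary S, bernProb p (innerEdges S) fun T => joinedIn T (S : Set (V d)) 0 q.1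

theorem exitMean_nonneg {p : ℝ} (hp : p ∈ Icc (0 : ℝ) 1) (S : Finset (V d)) :
    0 ≤ exitMean p S := Finset.sum_nonneg fun _ _ => bernProb_nonneg hp _ _

end Lattice

/-! ### Exponential decay below criticality -/

section Sharpness

variable {d : ℕ}

theorem dependsOnSet_joinedIn_of_eq {W : Finset (V d)} {U : Set (V d)} (h : (W : Set (V d)) = U)
    (x z : V d) : DependsOnSet (fun T => joinedIn T U x z) (innerEdges W) :=
  h ▸ dependsOnSet_joinedIn W x z

/-- A path from `x ∈ S` to `z ∉ S` has a last edge leaving the cluster of `x` in `S`. -/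
theorem exists_exit_edge {T : Set (Sym2 (V d))} {W S : Set (V d)} {x z : V d} (hx : x ∈ S)
    (hz : z ∉ S) (h : joinedIn T W x z) :
    ∃ a b, a ∈ clusterIn T S {x} ∧ b ∉ S ∧ latAdj a b ∧ s(a, b) ∈ T ∧
      joinedIn T (W \ clusterIn T S {x}) b z := by
  have hC : clusterIn T S {x} ⊆ S := clusterIn_subset (by simpa using hx)
  have key : z ∈ clusterIn T S {x} ∨ ∃ a b, a ∈ clusterIn T S {x} ∧ b ∉ S ∧ latAdj a b ∧
      s(a, b) ∈ T ∧ joinedIn T (W \ clusterIn T S {x}) b z := by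
    clear hz
    induction h with
    | refl => exact .inl (subset_clusterIn _ _ _ rfl)
    | @tail b c _ hbc ih =>
      obtain ⟨h1, h2, h3, h4⟩ := hbc
      by_cases hc : c ∈ clusterIn T S {x}
      · exact .inl hc
      · by_cases hb : b ∈ clusterIn T S {x}
        · refine .inr ⟨b, c, hb, fun hcS => hc ?_, h1, h2, .refl⟩
          exact mem_clusterIn_of_adj hb h1 h2 (hC hb) hcS
        · rcases ih with h | ⟨a, b', ha, hb', hab, hT, hj⟩
          · exact absurd h hb
          · exact .inr ⟨a, b', ha, hb', hab, hT, hj.tail ⟨h1, h2, ⟨h3, hb⟩, ⟨h4, hc⟩⟩⟩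
  exact key.resolve_left fun h => hz (hC h)

theorem reachProb_le_mul {p : ℝ} (hp : p ∈ Icc (0 : ℝ) 1) {S : Finset (V d)}
    (h0 : (0 : V d) ∈ S) {L : ℕ} (hS : ∀ x ∈ S, supDist x 0 < L)
    {n : ℕ} (hn : L ≤ n) :
    reachProb p (0 : V d) n ≤ p * exitMean p S * reachProb p (0 : V d) (n - L) := by
  classical
  set W : Finset (V d) := supBall 0 n with hW
  set E := innerEdges W with hE
  have hSW : S ⊆ W := fun x hx => mem_supBall.2 ((hS x hx).le.trans hn)
  have hq2 : ∀ q ∈ orientedBoundary S, supDist q.2 0 ≤ L := fun q hq => by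
    rw [mem_orientedBoundary] at hq
    have h1 := supDist_triangle q.2 q.1 0
    have h2 := supDist_le_one (latAdj_symm hq.2.2)
    have h3 := hS _ hq.1
    omega
  let ev : Finset (V d) × (V d × V d) → Set (Sym2 (V d)) → Prop := fun i T =>
    ((clusterIn T S {0} = (i.1 : Set (V d)) ∧ i.2.1 ∈ i.1) ∧ s(i.2.1, i.2.2) ∈ T) ∧
      ∃ z, n - L ≤ supDist z i.2.2 ∧ joinedIn T ((W : Set (V d)) \ i.1) i.2.2 z
  have hcover : ∀ T, reaches 0 n T → ∃ i ∈ S.powerset ×ˢ orientedBoundary S, ev i T := by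
    rintro T ⟨z, hz, hj⟩
    have hzS : z ∉ (S : Set (V d)) := fun h => by have := hS z h; omega
    obtain ⟨a, b, ha, hb, hab, hT, hj'⟩ := exists_exit_edge (S := S) (by simpa using h0) hzS hj
    have hC : clusterIn T (S : Set (V d)) {0} ⊆ S := clusterIn_subset (by simpa using h0)
    have hfin : (clusterIn T (S : Set (V d)) {0}).Finite := S.finite_toSet.subset hC
    have haS := hC ha
    have hbd : (a, b) ∈ orientedBoundary S := mem_orientedBoundary.2 ⟨haS, hb, hab⟩
    refine ⟨(hfin.toFinset, (a, b)), ?_, ⟨⟨⟨by simp, by simpa using ha⟩, hT⟩, z, ?_, ?_⟩⟩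
    · rw [Finset.mem_product, Finset.mem_powerset]
      refine ⟨fun x hx => hC (by simpa using hx), hbd⟩
    · have h1 := supDist_triangle z b 0
      have h2 := hq2 _ hbd
      simp only at h2 ⊢
      omega
    · simpa using hj'
  have hbound : ∀ i ∈ S.powerset ×ˢ orientedBoundary S, bernProb p E (ev i) ≤
      bernProb p E (fun T => clusterIn T S {0} = (i.1 : Set (V d)) ∧ i.2.1 ∈ i.1) * p *
        reachProb p (0 : V d) (n - L) := by
    rintro ⟨C, a, b⟩ hi
    rw [Finset.mem_product, Finset.mem_powerset] at hi
    obtain ⟨hCS, hbd⟩ := hi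
    simp only at hCS hbd
    have hb := hq2 _ hbd
    obtain ⟨haS, hbS, hab⟩ := mem_orientedBoundary.1 hbd
    simp only at hb haS hbS hab
    have hR : 0 ≤ reachProb p (0 : V d) (n - L) := reachProb_nonneg hp _ _
    by_cases haC : a ∈ C
    · have d1 : DependsOnSet (fun T => clusterIn T S {0} = (C : Set (V d)) ∧ a ∈ C)
          (touchingEdges S (C : Set (V d))) := fun T =>
        and_congr_left fun _ => dependsOnSet_clusterIn_eq S {0} C T
      have d2 : DependsOnSet (fun T : Set (Sym2 (V d)) => s(a, b) ∈ T) {s(a, b)} := fun T => by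
        simp
      have d3 : DependsOnSet (fun T => ∃ z, n - L ≤ supDist z b ∧
          joinedIn T ((W : Set (V d)) \ C) b z) (innerEdges (W \ C)) :=
        DependsOnSet.exists fun z =>
          (dependsOnSet_joinedIn_of_eq (by simp) b z).const_and _
      have hbC : b ∉ C := fun h => hbS (hCS h)
      have j12 : Disjoint (touchingEdges S (C : Set (V d)) : Set (Sym2 (V d))) {s(a, b)} := by
        rw [Set.disjoint_singleton_right, Finset.mem_coe, mk_mem_touchingEdges]
        tauto
      have j3 : Disjoint ((touchingEdges S (C : Set (V d)) : Set (Sym2 (V d))) ∪ {s(a, b)})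
          (innerEdges (W \ C)) := by
        rw [Set.disjoint_left]
        intro e he he'
        have hnot : ∀ v ∈ e, v ∉ C := fun v hv =>
          (Finset.mem_sdiff.1 (mem_of_mem_innerEdges he' hv)).2
        rcases he with he | rfl
        · obtain ⟨v, hv, hve⟩ := exists_mem_of_mem_touchingEdges he
          exact hnot v hve hv
        · exact hnot a (by simp) haC
      have hab_mem : s(a, b) ∈ E := mk_mem_innerEdges.2
        ⟨hSW haS, mem_supBall.2 (hb.trans hn), hab⟩
      have := bernProb_and (p := p) E (d1.and d2) d3 j3
      rw [bernProb_and E d1 d2 j12, bernProb_mem p hab_mem] at this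
      refine this.le.trans (mul_le_mul_of_nonneg_left ?_
        (mul_nonneg (bernProb_nonneg hp _ _) hp.1))
      rw [← reachProb_eq p b, reachProb, ← bernProb_eq_of_subset (dependsOnSet_reaches b (n - L))
        (t := E)]
      · exact bernProb_mono hp _ fun T ⟨z, hz, hj⟩ => reaches_of_joinedIn hj hz
      · refine innerEdges_mono fun z hz => mem_supBall.2 ?_
        have h1 := mem_supBall.1 hz
        have h2 := supDist_triangle z b 0
        omega
    · have h0 : bernProb p E (ev (C, a, b)) ≤ bernProb p E
          (fun T => clusterIn T S {0} = (C : Set (V d)) ∧ a ∈ C) :=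
        bernProb_mono hp _ fun T h => absurd h.1.1.2 haC
      have h1 : bernProb p E (fun T => clusterIn T S {0} = (C : Set (V d)) ∧ a ∈ C) = 0 := by
        simp [bernProb, haC]
      simp only
      rw [h1] at h0 ⊢
      simpa using h0
  calc reachProb p (0 : V d) n
      ≤ ∑ i ∈ S.powerset ×ˢ orientedBoundary S, bernProb p E (ev i) :=
        bernProb_le_sum hp E _ _ _ hcover
    _ ≤ _ := Finset.sum_le_sum hbound
    _ = (∑ q ∈ orientedBoundary S, ∑ C ∈ S.powerset, bernProb p E
          (fun T => clusterIn T S {0} = (C : Set (V d)) ∧ q.1 ∈ C)) * p *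
          reachProb p (0 : V d) (n - L) := by
        rw [← Finset.sum_mul, ← Finset.sum_mul, Finset.sum_product_right]
    _ ≤ exitMean p S * p * reachProb p (0 : V d) (n - L) := by
        refine mul_le_mul_of_nonneg_right (mul_le_mul_of_nonneg_right ?_ hp.1)
          (reachProb_nonneg hp _ _)
        refine Finset.sum_le_sum fun q hq => ?_
        rw [← bernProb_eq_of_subset (dependsOnSet_joinedIn S 0 q.1) (innerEdges_mono hSW)]
        have := sum_bernProb_le_of_injOn hp E S.powerset (Finset.univ : Finset Unit)
          (fun C T => clusterIn T S {0} = (C : Set (V d)) ∧ q.1 ∈ C)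
          (fun _ T => joinedIn T S 0 q.1) (fun _ => ()) ?_ ?_
        · simpa using this
        · rintro T C - ⟨h1, h2⟩
          refine ⟨by simp, ?_⟩
          rw [← Finset.mem_coe, ← h1] at h2
          obtain ⟨a, rfl, h⟩ := h2
          exact h
        · rintro T C - C' - ⟨h1, -⟩ ⟨h2, -⟩ -
          exact Finset.coe_injective (h1.symm.trans h2)
    _ = _ := by ring

/-- If the expected number of exits from some finite set is less than one, the connection
probabilities are summable. -/
theorem summable_reachProb {p : ℝ} (hp : p ∈ Icc (0 : ℝ) 1) {S : Finset (V d)}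
    (h0 : (0 : V d) ∈ S) (hS : p * exitMean p S < 1) :
    Summable (reachProb p (0 : V d)) := by
  set L := S.sup (fun x => supDist x 0) + 1 with hL
  have hSL : ∀ x ∈ S, supDist x 0 < L := fun x hx =>
    Nat.lt_succ_of_le (Finset.le_sup (f := fun x => supDist x 0) hx)
  set a := p * exitMean p S with ha
  have ha0 : 0 ≤ a := mul_nonneg hp.1 (exitMean_nonneg hp S)
  have hnn : ∀ n, 0 ≤ reachProb p (0 : V d) n := reachProb_nonneg hp 0
  have hbound : ∀ N, ∑ n ∈ Finset.range N, reachProb p (0 : V d) n ≤ L / (1 - a) := by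
    intro N
    have h1 : ∑ n ∈ Finset.range N, reachProb p (0 : V d) n ≤
        ∑ n ∈ Finset.range (L + N), reachProb p (0 : V d) n :=
      Finset.sum_le_sum_of_subset_of_nonneg (by simp) fun n _ _ => hnn n
    have h2 : ∑ n ∈ Finset.range L, reachProb p (0 : V d) n ≤ L := by
      simpa using Finset.sum_le_card_nsmul (Finset.range L) _ 1
        fun n _ => reachProb_le_one hp (0 : V d) n
    have h3 : ∑ n ∈ Finset.range N, reachProb p (0 : V d) (L + n) ≤
        a * ∑ n ∈ Finset.range N, reachProb p (0 : V d) n := by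
      rw [Finset.mul_sum]
      refine Finset.sum_le_sum fun n _ => ?_
      simpa using reachProb_le_mul hp h0 hSL (n := L + n) (by omega)
    rw [Finset.sum_range_add] at h1
    rw [le_div_iff₀ (by linarith)]
    linarith
  exact summable_of_sum_range_le hnn hbound

/-- Differential inequality for connection probabilities. -/
theorem exists_hasDerivAt_reachProb {p : ℝ} (hp : p ∈ Icc (0 : ℝ) 1)
    (h : ∀ S : Finset (V d), (0 : V d) ∈ S → 1 ≤ exitMean p S) (n : ℕ) :
    ∃ D, HasDerivAt (fun q => reachProb q (0 : V d) n) D p ∧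
      1 - reachProb p (0 : V d) n ≤ D := by
  classical
  set W : Finset (V d) := supBall 0 n with hW
  set E := innerEdges W with hE
  set A : Set (V d) := {z | z ∈ W ∧ n ≤ supDist z 0} with hA
  have hAW : A ⊆ W := fun z hz => hz.1
  have h0W : (0 : V d) ∈ W := mem_supBall.2 (by rw [supDist_self]; omega)
  have hreach : ∀ T, reaches (0 : V d) n T ↔ 0 ∈ clusterIn T W A := fun T => by
    constructor
    · rintro ⟨z, hz, hj⟩
      exact ⟨z, ⟨hj.mem h0W, hz⟩, hj.symm⟩
    · rintro ⟨z, hz, hj⟩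
      exact ⟨z, hz.2, hj.symm⟩
  obtain ⟨D, hD, hle⟩ := exists_hasDerivAt_bernProb hp E (A := reaches (0 : V d) n)
    fun T U hTU => reaches.mono hTU
  refine ⟨D, hD, le_trans ?_ hle⟩
  set I := W.powerset.filter (fun C => (0 : V d) ∉ C) with hI
  let ev : (Σ _ : Finset (V d), V d × V d) → Set (Sym2 (V d)) → Prop := fun i T =>
    clusterIn T W A = (i.1 : Set (V d)) ∧ joinedIn T ((W \ i.1 : Finset (V d)) : Set (V d)) 0 i.2.1
  have hpiv : ∑ i ∈ I.sigma (fun C => orientedBoundary (W \ C)), bernProb p E (ev i) ≤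
      ∑ e ∈ E, bernProb p E (fun T => ¬ reaches (0 : V d) n T ∧ reaches 0 n (insert e T)) := by
    refine sum_bernProb_le_of_injOn hp E _ _ _ _ (fun i => s(i.2.1, i.2.2)) ?_ ?_
    · rintro T ⟨C, x, y⟩ hi ⟨hC, hj⟩
      simp only [hI, Finset.mem_sigma, Finset.mem_filter, Finset.mem_powerset,
        mem_orientedBoundary] at hi hC hj ⊢
      obtain ⟨⟨hCW, h0C⟩, hx, hy, hxy⟩ := hi
      have hxC : x ∉ C := (Finset.mem_sdiff.1 hx).2
      have hxW : x ∈ W := (Finset.mem_sdiff.1 hx).1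
      have hxA : x ∉ A := fun h => hxC (by
        rw [← Finset.mem_coe, ← hC]; exact subset_clusterIn _ _ _ h)
      have hxn : supDist x 0 < n := by
        by_contra hlt
        exact hxA ⟨hxW, by omega⟩
      have hyW : y ∈ W := by
        refine mem_supBall.2 ?_
        have h1 := supDist_triangle y x 0
        have h2 := supDist_le_one (latAdj_symm hxy)
        omega
      have hyC : y ∈ C := by
        by_contra hyC
        exact hy (Finset.mem_sdiff.2 ⟨hyW, hyC⟩)
      refine ⟨mk_mem_innerEdges.2 ⟨hxW, hyW, hxy⟩, ?_, ?_⟩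
      · rwa [hreach, hC]
      · rw [hreach]
        have hy' : y ∈ clusterIn (insert s(x, y) T) W A := by
          apply clusterIn_mono _ _ (subset_insert _ T)
          rw [hC]; exact hyC
        have hx' := mem_clusterIn_of_adj hy' (latAdj_symm hxy)
          (by rw [Sym2.eq_swap]; exact mem_insert _ _) hyW hxW
        obtain ⟨a, ha, haj⟩ := hx'
        refine ⟨a, ha, haj.trans (hj.symm.mono (subset_insert _ _) ?_)⟩
        exact fun v hv => (Finset.mem_sdiff.1 hv).1
    · rintro T ⟨C, x, y⟩ hi ⟨C', x', y'⟩ hi' ⟨hC, -⟩ ⟨hC', -⟩ heq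
      have hCC : C = C' := Finset.coe_injective (hC.symm.trans hC')
      subst hCC
      simp only [Finset.mem_sigma, mem_orientedBoundary] at hi hi' heq
      rcases Sym2.eq_iff.1 heq with ⟨rfl, rfl⟩ | ⟨rfl, rfl⟩
      · rfl
      · exact absurd hi.2.1 hi'.2.2.1
  refine le_trans ?_ hpiv
  rw [Finset.sum_sigma]
  have hC : ∀ C ∈ I, bernProb p E (fun T => clusterIn T W A = (C : Set (V d))) ≤
      ∑ q ∈ orientedBoundary (W \ C), bernProb p E (ev ⟨C, q⟩) := by
    intro C hC
    have h0C : (0 : V d) ∈ W \ C := Finset.mem_sdiff.2 ⟨h0W, (Finset.mem_filter.1 hC).2⟩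
    have hdis : Disjoint (touchingEdges W (C : Set (V d)) : Set (Sym2 (V d)))
        (innerEdges (W \ C)) := by
      rw [Set.disjoint_left]
      intro e he he'
      obtain ⟨v, hv, hve⟩ := exists_mem_of_mem_touchingEdges he
      exact (Finset.mem_sdiff.1 (mem_of_mem_innerEdges he' hve)).2 hv
    have hq : ∀ q ∈ orientedBoundary (W \ C), bernProb p E (ev ⟨C, q⟩) =
        bernProb p E (fun T => clusterIn T W A = (C : Set (V d))) *
          bernProb p (innerEdges (W \ C))
            (fun T => joinedIn T ((W \ C : Finset (V d)) : Set (V d)) 0 q.1) := by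
      intro q _
      rw [← bernProb_eq_of_subset (dependsOnSet_joinedIn (W \ C) 0 q.1)
        (innerEdges_mono Finset.sdiff_subset)]
      exact bernProb_and E (dependsOnSet_clusterIn_eq W A C)
        (dependsOnSet_joinedIn (W \ C) 0 q.1) hdis
    rw [Finset.sum_congr rfl hq, ← Finset.mul_sum]
    exact le_mul_of_one_le_right (bernProb_nonneg hp _ _) (h _ h0C)
  refine le_trans ?_ (Finset.sum_le_sum hC)
  rw [reachProb, ← bernProb_compl]
  refine bernProb_le_sum hp E I _ _ fun T hT => ?_
  have hfin : (clusterIn T W A).Finite := W.finite_toSet.subset (clusterIn_subset hAW)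
  refine ⟨hfin.toFinset, ?_, by simp⟩
  rw [hI, Finset.mem_filter, Finset.mem_powerset]
  refine ⟨fun x hx => clusterIn_subset hAW (hfin.mem_toFinset.1 hx), ?_⟩
  rwa [hfin.mem_toFinset, ← hreach]

/-- If every finite set has expected number of exits at least one throughout `[p, p']`, then
connections to distance `n` at `p'` have probability bounded away from zero. -/
theorem le_reachProb {p p' : ℝ} (hp : 0 ≤ p) (hpp : p ≤ p') (hp' : p' ≤ 1)
    (h : ∀ q ∈ Icc p p', ∀ S : Finset (V d), (0 : V d) ∈ S → 1 ≤ exitMean q S) (n : ℕ) :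
    1 - Real.exp (p - p') ≤ reachProb p' (0 : V d) n := by
  have hsub : ∀ q ∈ Icc p p', q ∈ Icc (0 : ℝ) 1 := fun q hq =>
    ⟨hp.trans hq.1, hq.2.trans hp'⟩
  set g : ℝ → ℝ := fun q => (1 - reachProb q (0 : V d) n) * Real.exp q with hg
  have hder : ∀ q ∈ Icc p p', ∃ D, HasDerivAt g D q ∧ D ≤ 0 := fun q hq => by
    obtain ⟨D, hD, hle⟩ := exists_hasDerivAt_reachProb (hsub q hq) (h q hq) n
    refine ⟨_, (hD.const_sub 1).mul (Real.hasDerivAt_exp q), ?_⟩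
    nlinarith [Real.exp_pos q]
  have hanti : AntitoneOn g (Icc p p') := by
    refine antitoneOn_of_deriv_nonpos (convex_Icc p p') ?_ ?_ ?_
    · intro q hq
      obtain ⟨D, hD, -⟩ := hder q hq
      exact hD.continuousAt.continuousWithinAt
    · intro q hq
      obtain ⟨D, hD, -⟩ := hder q (interior_subset hq)
      exact hD.differentiableAt.differentiableWithinAt
    · intro q hq
      obtain ⟨D, hD, hle⟩ := hder q (interior_subset hq)
      rwa [hD.deriv]
  have h1 := hanti (left_mem_Icc.2 hpp) (right_mem_Icc.2 hpp) hpp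
  have h2 : g p ≤ Real.exp p := by
    have := reachProb_nonneg (hsub p (left_mem_Icc.2 hpp)) (0 : V d) n
    simp only [hg]
    nlinarith [Real.exp_pos p]
  have h3 : (1 - reachProb p' (0 : V d) n) * Real.exp p' ≤ Real.exp p := h1.trans h2
  rw [Real.exp_sub]
  have h4 := (le_div_iff₀ (Real.exp_pos p')).2 h3
  linarith

/-- Sharpness: if connections to distance `n` at some `p' > p` have probability not bounded
away from zero, then the connection probabilities at `p` are summable. -/
theorem summable_reachProb_of_lt {p p' : ℝ} (hp : 0 ≤ p) (hpp : p < p') (hp' : p' ≤ 1)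
    (h : ∀ c > 0, ∃ n, reachProb p' (0 : V d) n < c) : Summable (reachProb p (0 : V d)) := by
  by_cases hS : ∀ q ∈ Icc p p', ∀ S : Finset (V d), (0 : V d) ∈ S → 1 ≤ exitMean q S
  · obtain ⟨n, hn⟩ := h (1 - Real.exp (p - p'))
      (by rw [gt_iff_lt, sub_pos, Real.exp_lt_one_iff]; linarith)
    exact absurd (le_reachProb hp hpp.le hp' hS n) (not_le.2 hn)
  · push Not at hS
    obtain ⟨q, hq, S, h0, hlt⟩ := hS
    have hp01 : p ∈ Icc (0 : ℝ) 1 := ⟨hp, hpp.le.trans hp'⟩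
    have hq01 : q ∈ Icc (0 : ℝ) 1 := ⟨hp.trans hq.1, hq.2.trans hp'⟩
    have hsum := summable_reachProb hq01 h0
      ((mul_le_of_le_one_left (exitMean_nonneg hq01 S) hq01.2).trans_lt hlt)
    exact hsum.of_nonneg_of_le (reachProb_nonneg hp01 0) fun n =>
      bernProb_monotoneOn _ (fun T U hTU => reaches.mono hTU) hp01 hq01 hq.1

end Sharpness

/-! ### Boundaryless plaquette sets -/

section Surfaces

variable {d : ℕ}

open scoped Classical in
/-- The `ZMod 2`-valued indicator of membership. -/
noncomputable def modTwoInd {α : Type*} (K : Set α) (e : α) : ZMod 2 := if e ∈ K then 1 else 0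

theorem modTwoInd_of_notMem {α : Type*} {K : Set α} {e : α} (h : e ∉ K) : modTwoInd K e = 0 :=
  if_neg h

theorem modTwoInd_of_mem {α : Type*} {K : Set α} {e : α} (h : e ∈ K) : modTwoInd K e = 1 :=
  if_pos h

theorem natCast_ncard_inter {α : Type*} (K : Set α) {a b c e : α} (hab : a ≠ b) (hac : a ≠ c)
    (hae : a ≠ e) (hbc : b ≠ c) (hbe : b ≠ e) (hce : c ≠ e) :
    ((({a, b, c, e} : Set α) ∩ K).ncard : ZMod 2) =
      modTwoInd K a + modTwoInd K b + modTwoInd K c + modTwoInd K e := by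
  classical
  have : ({a, b, c, e} : Set α) ∩ K = (({a, b, c, e} : Finset α).filter (· ∈ K) : Finset α) := by
    ext x; simp
  rw [this, Set.ncard_coe_finset, ← Finset.sum_boole]
  rw [Finset.sum_insert (by simp [hab, hac, hae]), Finset.sum_insert (by simp [hbc, hbe]),
    Finset.sum_insert (by simp [hce]), Finset.sum_singleton]
  simp only [modTwoInd]
  ring

theorem uv_ne_zero (i : Fin d) : (uv i : V d) ≠ 0 := fun h => by
  simpa [uv] using congrFun h i

theorem uv_ne_uv {i j : Fin d} (h : i ≠ j) : (uv i : V d) ≠ uv j := fun h' => by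
  simpa [uv, h] using congrFun h' i

theorem latAdj_add_uv (x : V d) (i : Fin d) : latAdj x (x + uv i) :=
  ⟨i, by simp [uv], fun j hj => by simp [uv, hj]⟩

theorem natCast_ncard_edgesOf_inter (F : Square d) (K : Set (Sym2 (V d))) :
    ((edgesOf F ∩ K).ncard : ZMod 2) =
      modTwoInd K s(F.corner, F.corner + uv F.i) + modTwoInd K s(F.corner, F.corner + uv F.j) +
      modTwoInd K s(F.corner + uv F.i, F.corner + uv F.i + uv F.j) +
      modTwoInd K s(F.corner + uv F.j, F.corner + uv F.i + uv F.j) := by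
  obtain ⟨x, i, j, hij⟩ := F
  have hi := uv_ne_zero i
  have hj := uv_ne_zero j
  have h := uv_ne_uv hij
  have hs : (uv i + uv j : V d) ≠ 0 := fun h' => by
    simpa [uv, hij] using congrFun h' i
  refine natCast_ncard_inter K ?_ ?_ ?_ ?_ ?_ ?_ <;>
    simp [add_assoc, hi, hj, h, h.symm, hs]

theorem noBoundary_iff {K : Set (Sym2 (V d))} :
    NoBoundary K ↔ ∀ (x : V d) (i j : Fin d), i ≠ j →
      modTwoInd K s(x, x + uv i) + modTwoInd K s(x, x + uv j) +
      modTwoInd K s(x + uv i, x + uv i + uv j) + modTwoInd K s(x + uv j, x + uv i + uv j) = 0 := by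
  simp only [NoBoundary, ← ZMod.natCast_eq_zero_iff_even, natCast_ncard_edgesOf_inter]
  exact ⟨fun h x i j hij => h ⟨x, i, j, hij⟩, fun h F => h F.corner F.i F.j F.hij⟩

theorem sum_range_add_succ_zmod_two (f : ℕ → ZMod 2) (n : ℕ) :
    ∑ t ∈ Finset.range n, (f t + f (t + 1)) = f 0 + f n := by
  induction n with
  | zero => simp [CharTwo.add_self_eq_zero]
  | succ n ih =>
    rw [Finset.sum_range_succ, ih]
    linear_combination CharTwo.add_self_eq_zero (f n)

theorem exists_bound_of_finite {K : Set (Sym2 (V d))} (hK : K.Finite) :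
    ∃ M : ℕ, ∀ x y : V d, s(x, y) ∈ K → ∀ i, (x i).natAbs < M := by
  have hU : (⋃ e ∈ K, {v : V d | v ∈ e}).Finite := by
    refine hK.biUnion fun e _ => ?_
    induction e with
    | _ a b =>
      refine (Set.toFinite {a, b}).subset fun v hv => ?_
      simpa using hv
  refine ⟨hU.toFinset.sup (fun v => supDist v 0) + 1, fun x y hxy i => ?_⟩
  have hx : x ∈ hU.toFinset := by
    rw [hU.mem_toFinset]
    exact mem_biUnion hxy (by simp)
  have h1 := Finset.le_sup (f := fun v => supDist v 0) hx
  have h2 := natAbs_sub_le_supDist x 0 i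
  simp only [Pi.zero_apply, sub_zero] at h2
  omega

/-- A finite boundaryless set of plaquettes meets every coordinate line evenly. -/
theorem sum_modTwoInd_eq_zero {K : Set (Sym2 (V d))} (hK : K.Finite) (hN : NoBoundary K)
    {i j : Fin d} (hij : i ≠ j) {N : ℕ}
    (hline : ∀ t : ℤ, s(t • uv i, t • uv i + uv i) ∈ K → 0 ≤ t ∧ t < N) :
    ∑ t ∈ Finset.range N, modTwoInd K s((t : ℤ) • uv i, (t : ℤ) • uv i + uv i) = 0 := by
  obtain ⟨M, hM⟩ := exists_bound_of_finite hK
  let pt : ℕ → ℕ → V d := fun k t => ((t : ℤ) - M) • uv i + (k : ℤ) • uv j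
  have hpt_i : ∀ k t, pt k t i = t - M := fun k t => by simp [pt, uv, hij]
  have hpt_j : ∀ k t, pt k t j = k := fun k t => by simp [pt, uv, hij.symm]
  have hpt_k : ∀ k t, pt k t + uv j = pt (k + 1) t := fun k t => by
    simp only [pt]; push_cast; rw [add_smul, one_smul, add_assoc]
  have hpt_t : ∀ k t, pt k t + uv i = pt k (t + 1) := fun k t => by
    simp only [pt]; push_cast
    rw [show (t : ℤ) + 1 - M = (t - M) + 1 by ring, add_smul, one_smul]; abel
  let ℓ : ℕ → ZMod 2 := fun k =>
    ∑ t ∈ Finset.range (M + (N + M)), modTwoInd K s(pt k t, pt k t + uv i)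
  have hstep : ∀ k, ℓ k = ℓ (k + 1) := by
    intro k
    rw [← CharTwo.add_eq_zero, ← Finset.sum_add_distrib]
    have h1 : ∀ t, modTwoInd K s(pt k t, pt k t + uv i) +
        modTwoInd K s(pt (k + 1) t, pt (k + 1) t + uv i) =
        modTwoInd K s(pt k t, pt k t + uv j) +
          modTwoInd K s(pt k (t + 1), pt k (t + 1) + uv j) := fun t => by
      have h := noBoundary_iff.1 hN (pt k t) i j hij
      rw [add_right_comm (pt k t), hpt_k k t] at h
      rw [← hpt_t k t, add_right_comm (pt k t), hpt_k k t]
      have h2 := CharTwo.add_self_eq_zero (modTwoInd K s(pt k t, pt (k + 1) t))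
      have h3 := CharTwo.add_self_eq_zero
        (modTwoInd K s(pt k t + uv i, pt (k + 1) t + uv i))
      linear_combination h - h2 - h3
    rw [Finset.sum_congr rfl fun t _ => h1 t,
      sum_range_add_succ_zmod_two (fun t => modTwoInd K s(pt k t, pt k t + uv j)),
      modTwoInd_of_notMem, modTwoInd_of_notMem, add_zero]
    · intro h
      have := hM _ _ h i
      rw [hpt_i] at this; omega
    · intro h
      have := hM _ _ h i
      rw [hpt_i] at this; omega
  have hconst : ∀ k, ℓ 0 = ℓ k := fun k => by
    induction k with
    | zero => rfl
    | succ k ih => rw [ih, hstep]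
  have hzero : ℓ 0 = 0 := by
    rw [hconst M]
    refine Finset.sum_eq_zero fun t _ => modTwoInd_of_notMem fun h => ?_
    have := hM _ _ h j
    rw [hpt_j] at this; omega
  have hpt0 : ∀ t : ℕ, pt 0 t = ((t : ℤ) - M) • uv i := fun t => by simp [pt]
  change ∑ t ∈ Finset.range (M + (N + M)), modTwoInd K s(pt 0 t, pt 0 t + uv i) = 0 at hzero
  rw [Finset.sum_range_add, Finset.sum_range_add] at hzero
  rw [Finset.sum_eq_zero (s := Finset.range M), Finset.sum_eq_zero (s := Finset.range M),
    zero_add, add_zero] at hzero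
  · rw [← hzero]
    refine Finset.sum_congr rfl fun t _ => ?_
    rw [hpt0]; push_cast; rw [add_sub_cancel_left]
  · intro t _
    refine modTwoInd_of_notMem fun h => ?_
    rw [hpt0] at h
    have := hline _ h
    push_cast at this; omega
  · intro t ht
    refine modTwoInd_of_notMem fun h => ?_
    rw [hpt0] at h
    have := hline _ h
    have := Finset.mem_range.1 ht
    omega

/-- The edge boundary of a set of vertices. -/
def edgeBoundary (S : Set (V d)) : Set (Sym2 (V d)) :=
  {e | ∃ x y, latAdj x y ∧ x ∈ S ∧ y ∉ S ∧ e = s(x, y)}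

theorem mk_mem_edgeBoundary {S : Set (V d)} {x y : V d} (h : latAdj x y) :
    s(x, y) ∈ edgeBoundary S ↔ (x ∈ S ∧ y ∉ S) ∨ (y ∈ S ∧ x ∉ S) := by
  constructor
  · rintro ⟨a, b, _, ha, hb, hab⟩
    rcases Sym2.eq_iff.1 hab with ⟨rfl, rfl⟩ | ⟨rfl, rfl⟩
    · exact .inl ⟨ha, hb⟩
    · exact .inr ⟨ha, hb⟩
  · rintro (⟨hx, hy⟩ | ⟨hy, hx⟩)
    · exact ⟨x, y, h, hx, hy, rfl⟩
    · exact ⟨y, x, latAdj_symm h, hy, hx, Sym2.eq_swap⟩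

theorem modTwoInd_edgeBoundary {S : Set (V d)} {x y : V d} (h : latAdj x y) :
    modTwoInd (edgeBoundary S) s(x, y) = modTwoInd S x + modTwoInd S y := by
  have h2 : (1 : ZMod 2) + 1 = 0 := rfl
  by_cases hx : x ∈ S <;> by_cases hy : y ∈ S <;>
    simp [modTwoInd, mk_mem_edgeBoundary h, hx, hy, h2]

theorem noBoundary_edgeBoundary (S : Set (V d)) : NoBoundary (edgeBoundary S) := by
  rw [noBoundary_iff]
  intro x i j _
  have h : latAdj (x + uv j) (x + uv i + uv j) := by
    rw [add_right_comm]; exact latAdj_add_uv _ _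
  rw [modTwoInd_edgeBoundary (latAdj_add_uv _ _), modTwoInd_edgeBoundary (latAdj_add_uv _ _),
    modTwoInd_edgeBoundary (latAdj_add_uv _ _), modTwoInd_edgeBoundary h]
  linear_combination CharTwo.add_self_eq_zero (modTwoInd S x) +
    CharTwo.add_self_eq_zero (modTwoInd S (x + uv i)) +
    CharTwo.add_self_eq_zero (modTwoInd S (x + uv j)) +
    CharTwo.add_self_eq_zero (modTwoInd S (x + uv i + uv j))

/-- The connected component of `e` in a set `B` of plaquettes. -/
def plaqComp (B : Set (Sym2 (V d))) (e : Sym2 (V d)) : Set (Sym2 (V d)) :=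
  {f | ReflTransGen (fun u v => plaqAdj u v ∧ u ∈ B ∧ v ∈ B) e f}

theorem plaqAdj_symm {e f : Sym2 (V d)} (h : plaqAdj e f) : plaqAdj f e :=
  ⟨h.1.symm, h.2.imp fun _ h => h.symm⟩

theorem mem_plaqComp_symm {B : Set (Sym2 (V d))} {e f : Sym2 (V d)} (h : f ∈ plaqComp B e) :
    e ∈ plaqComp B f := by
  induction h with
  | refl => exact .refl
  | tail _ h ih => exact .head ⟨plaqAdj_symm h.1, h.2.2, h.2.1⟩ ih

theorem plaqComp_eq_of_mem {B : Set (Sym2 (V d))} {e f : Sym2 (V d)} (h : f ∈ plaqComp B e) :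
    plaqComp B f = plaqComp B e :=
  Subset.antisymm (fun _ hg => ReflTransGen.trans h hg)
    fun _ hg => ReflTransGen.trans (mem_plaqComp_symm h) hg

theorem plaqComp_subset {B : Set (Sym2 (V d))} {e : Sym2 (V d)} (he : e ∈ B) :
    plaqComp B e ⊆ B := fun f hf => by
  rcases ReflTransGen.cases_tail hf with rfl | ⟨_, _, h⟩
  · exact he
  · exact h.2.2

theorem plaqConnected_plaqComp (B : Set (Sym2 (V d))) (e : Sym2 (V d)) :
    PlaqConnected (plaqComp B e) := by
  intro a ha b hb
  have hab : b ∈ plaqComp B a := by rw [plaqComp_eq_of_mem ha]; exact hb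
  clear hb
  induction hab with
  | refl => exact .refl
  | @tail c f hac hcf ih =>
    have hc : c ∈ plaqComp B e := ReflTransGen.trans ha hac
    exact ih.tail ⟨hcf.1, hc, ReflTransGen.tail hc hcf⟩

theorem noBoundary_plaqComp {B : Set (Sym2 (V d))} (hB : NoBoundary B) {e : Sym2 (V d)}
    (he : e ∈ B) : NoBoundary (plaqComp B e) := by
  intro F
  rcases (edgesOf F ∩ plaqComp B e).eq_empty_or_nonempty with h | ⟨f, hfF, hf⟩
  · simp [h]
  · have : edgesOf F ∩ plaqComp B e = edgesOf F ∩ B := by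
      refine Subset.antisymm (inter_subset_inter_right _ (plaqComp_subset he)) ?_
      rintro g ⟨hgF, hg⟩
      refine ⟨hgF, ?_⟩
      by_cases hfg : f = g
      · exact hfg ▸ hf
      · exact ReflTransGen.tail hf ⟨⟨hfg, F, hfF, hgF⟩, plaqComp_subset he hf, hg⟩
    rw [this]
    exact hB F

/-- If some union of open clusters contains one end of a coordinate axis and avoids the other,
then there is an infinite open surface. -/
theorem infOpenSurface_of_separates {ω : Config d} {S : Set (V d)}
    (hS : ∀ x ∈ S, ∀ y, latAdj x y → ω s(x, y) = true → y ∈ S) {i j : Fin d} (hij : i ≠ j)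
    {N : ℕ} (hneg : ∀ t : ℤ, t ≤ 0 → t • uv i ∈ S) (hpos : ∀ t : ℤ, N ≤ t → t • uv i ∉ S) :
    InfOpenSurface ω := by
  classical
  set B := edgeBoundary S with hB
  let h : ℤ → Sym2 (V d) := fun t => s(t • uv i, t • uv i + uv i)
  have hsucc : ∀ t : ℤ, t • (uv i : V d) + uv i = (t + 1) • uv i := fun t => by
    rw [add_smul, one_smul]
  have hclosed : ∀ e ∈ B, IsEdge e ∧ ω e = false := by
    rintro e ⟨x, y, hxy, hx, hy, rfl⟩
    refine ⟨⟨x, y, hxy, rfl⟩, ?_⟩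
    by_contra hne
    exact hy (hS x hx y hxy (by simpa using hne))
  by_contra hno
  have hfin : ∀ e ∈ B, (plaqComp B e).Finite := fun e he => by
    by_contra hinf
    exact hno ⟨_, hinf, fun f hf => hclosed f (plaqComp_subset he hf),
      plaqConnected_plaqComp B e, noBoundary_plaqComp (noBoundary_edgeBoundary S) he⟩
  have hrange : ∀ t : ℤ, h t ∈ B → 0 ≤ t ∧ t < N := fun t ht => by
    rw [hB, mk_mem_edgeBoundary (latAdj_add_uv _ _), hsucc] at ht
    constructor
    · by_contra hlt
      have h1 := hneg t (by omega)
      have h2 := hneg (t + 1) (by omega)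
      tauto
    · by_contra hlt
      have h1 := hpos t (by omega)
      have h2 := hpos (t + 1) (by omega)
      tauto
  set D := (Finset.range N).filter (fun t : ℕ => h t ∈ B) with hD
  have hodd : ((D.card : ℕ) : ZMod 2) = 1 := by
    rw [hD, ← Finset.sum_boole]
    have h1 : ∀ t ∈ Finset.range N, (if h t ∈ B then (1 : ZMod 2) else 0) =
        modTwoInd S ((t : ℤ) • uv i) + modTwoInd S (((t + 1 : ℕ) : ℤ) • uv i) := fun t _ => by
      push_cast
      rw [← hsucc, ← modTwoInd_edgeBoundary (latAdj_add_uv _ _), modTwoInd]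
    rw [Finset.sum_congr rfl h1,
      sum_range_add_succ_zmod_two (fun t : ℕ => modTwoInd S ((t : ℤ) • uv i)),
      modTwoInd_of_mem (hneg _ (by simp)), modTwoInd_of_notMem (hpos _ le_rfl), add_zero]
  have heven : ((D.card : ℕ) : ZMod 2) = 0 := by
    rw [Finset.card_eq_sum_card_image (fun t : ℕ => plaqComp B (h t)) D, Nat.cast_sum]
    refine Finset.sum_eq_zero fun K hK => ?_
    obtain ⟨t₀, ht₀, rfl⟩ := Finset.mem_image.1 hK
    have hB₀ := (Finset.mem_filter.1 ht₀).2
    have hsub := plaqComp_subset hB₀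
    rw [← sum_modTwoInd_eq_zero (hfin _ hB₀)
      (noBoundary_plaqComp (noBoundary_edgeBoundary S) hB₀) hij
      (fun t ht => hrange t (hsub ht))]
    unfold modTwoInd
    rw [Finset.sum_boole, hD, Finset.filter_filter]
    congr 2
    refine Finset.filter_congr fun t _ => ⟨?_, fun ht => ⟨hsub ht, plaqComp_eq_of_mem ht⟩⟩
    rintro ⟨-, ht⟩
    rw [← ht]
    exact .refl
  rw [heven] at hodd
  exact zero_ne_one hodd

end Surfaces

/-! ### Almost sure existence of an infinite open surface -/

section Measure

variable {d : ℕ}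

/-- The set of open edges of a configuration. -/
def openEdges (ω : Config d) : Set (Sym2 (V d)) := {e | ω e = true}

theorem IsBernoulli.prob_cylinder {P : Measure (Config d)} {p : ℝ} (hP : IsBernoulli P p)
    (hp : p ∈ Icc (0 : ℝ) 1) {s : Finset (Sym2 (V d))} (hs : ∀ e ∈ s, IsEdge e)
    {A : Set (Sym2 (V d)) → Prop} (hA : DependsOnSet A (s : Set (Sym2 (V d)))) :
    MeasurableSet {ω : Config d | A (openEdges ω)} ∧
      P {ω | A (openEdges ω)} = ENNReal.ofReal (bernProb p s A) := by
  classical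
  let f : Finset (Sym2 (V d)) → Sym2 (V d) → Bool := fun T e => decide (e ∈ T)
  let C : Finset (Sym2 (V d)) → Set (Config d) := fun T => {ω | ∀ e ∈ s, ω e = f T e}
  have hC : ∀ T, MeasurableSet (C T) := fun T => by
    have : C T = ⋂ e ∈ s, (fun ω : Config d => ω e) ⁻¹' {f T e} := by ext; simp [C]
    rw [this]
    exact s.measurableSet_biInter fun e _ => measurable_pi_apply e (measurableSet_singleton _)
  have hCT : ∀ T ∈ s.powerset, ∀ ω ∈ C T, openEdges ω ∩ (s : Set _) = T := by
    intro T hT ω hω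
    ext e
    constructor
    · rintro ⟨h1, h2⟩
      have := hω e h2
      rw [show ω e = true from h1] at this
      simpa [f] using this.symm
    · intro h
      have hes := Finset.mem_powerset.1 hT h
      exact ⟨(hω e hes).trans (decide_eq_true h), hes⟩
  have hunion : {ω : Config d | A (openEdges ω)} =
      ⋃ T ∈ s.powerset.filter (fun T : Finset (Sym2 (V d)) => A (T : Set _)), C T := by
    ext ω
    simp only [mem_ofPred_eq, mem_iUnion, exists_prop, Finset.mem_filter]
    constructor
    · intro h
      refine ⟨s.filter (fun e => ω e = true), ⟨by simp, ?_⟩, fun e he => ?_⟩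
      · rw [hA] at h
        convert h using 1
        ext e; simp [openEdges, and_comm]
      · by_cases h : ω e = true <;> simp [f, h, he]
    · rintro ⟨T, ⟨hT, h⟩, hω⟩
      rw [hA, hCT T hT ω hω]
      exact h
  have hdisj : Set.PairwiseDisjoint
      (↑(s.powerset.filter (fun T : Finset (Sym2 (V d)) => A (T : Set _)))) C := by
    intro T hT T' hT' hne
    refine Set.disjoint_left.2 fun ω h h' => hne ?_
    have h1 := hCT T (Finset.mem_filter.1 hT).1 ω h
    have h2 := hCT T' (Finset.mem_filter.1 hT').1 ω h'
    exact_mod_cast h1.symm.trans h2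
  have hnn : ∀ T : Finset (Sym2 (V d)), ∀ e ∈ s, 0 ≤ (if e ∈ T then p else 1 - p) := by
    intro T e _
    split_ifs
    · exact hp.1
    · linarith [hp.2]
  rw [hunion]
  refine ⟨Finset.measurableSet_biUnion _ fun T _ => hC T, ?_⟩
  rw [measure_biUnion_finset hdisj fun T _ => hC T, bernProb, ENNReal.ofReal_sum_of_nonneg,
    Finset.sum_filter]
  · refine Finset.sum_congr rfl fun T _ => ?_
    split_ifs with h
    · rw [one_mul, ENNReal.ofReal_prod_of_nonneg (hnn T)]
      refine (hP s hs (f T)).trans (Finset.prod_congr rfl fun e _ => ?_)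
      simp [f]
    · simp
  · intro T _
    exact mul_nonneg (by split_ifs <;> norm_num) (Finset.prod_nonneg (hnn T))

theorem IsBernoulli.prob_reaches {P : Measure (Config d)} {p : ℝ} (hP : IsBernoulli P p)
    (hp : p ∈ Icc (0 : ℝ) 1) (y : V d) (n : ℕ) :
    MeasurableSet {ω : Config d | reaches y n (openEdges ω)} ∧
      P {ω | reaches y n (openEdges ω)} = ENNReal.ofReal (reachProb p (0 : V d) n) := by
  rw [← reachProb_eq p y n]
  exact hP.prob_cylinder hp (fun e he => isEdge_of_mem_innerEdges he) (dependsOnSet_reaches y n)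

theorem exists_isBernoulli {p : ℝ} (hp : p ∈ Icc (0 : ℝ) 1) :
    ∃ P : Measure (Config d), IsProbabilityMeasure P ∧ IsBernoulli P p := by
  let μ : Measure Bool :=
    ENNReal.ofReal p • Measure.dirac true + ENNReal.ofReal (1 - p) • Measure.dirac false
  have hμ : ∀ b, μ {b} = ENNReal.ofReal (if b then p else 1 - p) := by
    intro b; cases b <;> simp [μ]
  have : IsProbabilityMeasure μ := ⟨by
    simp only [μ, Measure.add_apply, Measure.smul_apply, measure_univ, smul_eq_mul, mul_one]
    rw [← ENNReal.ofReal_add hp.1 (by linarith [hp.2])]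
    simp⟩
  refine ⟨Measure.infinitePi fun _ => μ, inferInstance, fun s _ f => ?_⟩
  have h := Measure.infinitePi_pi (μ := fun _ : Sym2 (V d) => μ) (s := s) (t := fun e => {f e})
    (fun e _ => measurableSet_singleton _)
  rw [show {ω : Config d | ∀ e ∈ s, ω e = f e} = (s : Set _).pi fun e => {f e} by
    ext; simp [Set.pi], h]
  exact Finset.prod_congr rfl fun e _ => hμ _

theorem openConn_of_joinedIn {ω : Config d} {W : Set (V d)} {x y : V d}
    (h : joinedIn (openEdges ω) W x y) : openConn ω x y :=
  ReflTransGen.mono (fun _ _ hab => ⟨hab.1, hab.2.1⟩) _ _ h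

theorem joinedIn_of_openConn {ω : Config d} {x y : V d} (h : openConn ω x y) :
    joinedIn (openEdges ω) univ x y :=
  ReflTransGen.mono (fun _ _ hab => ⟨hab.1, hab.2, mem_univ _, mem_univ _⟩) _ _ h

theorem inInfCluster_of_forall_reaches {ω : Config d} {x : V d}
    (h : ∀ n, reaches x n (openEdges ω)) : inInfCluster ω x := by
  intro hfin
  obtain ⟨N, hN⟩ := (hfin.image fun z => supDist z x).bddAbove
  obtain ⟨z, hz, hxz⟩ := h (N + 1)
  have := hN ⟨z, openConn_of_joinedIn hxz, rfl⟩
  simp only at this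
  omega

theorem exists_reachProb_lt {p : ℝ} (hp : p ∈ Icc (0 : ℝ) 1)
    (h : ∀ P : Measure (Config d), IsBernoulli P p → IsProbabilityMeasure P →
      P {ω | ∃ x, inInfCluster ω x} = 0) {c : ℝ} (hc : 0 < c) :
    ∃ n, reachProb p (0 : V d) n < c := by
  by_contra! hge
  obtain ⟨P, hprob, hP⟩ := exists_isBernoulli (d := d) hp
  let E : ℕ → Set (Config d) := fun n => {ω | reaches 0 n (openEdges ω)}
  have hE : ∀ n, MeasurableSet (E n) := fun n => (hP.prob_reaches hp 0 n).1
  have hanti : Antitone E := fun m n hmn ω hω => reaches.anti hmn hω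
  have hlim := tendsto_measure_iInter_atTop (μ := P) (fun n => (hE n).nullMeasurableSet) hanti
    ⟨0, measure_ne_top P _⟩
  have hzero : P (⋂ n, E n) = 0 := by
    refine measure_mono_null (fun ω hω => ?_) (h P hP hprob)
    exact ⟨0, inInfCluster_of_forall_reaches fun n => mem_iInter.1 hω n⟩
  have hle : ENNReal.ofReal c ≤ P (⋂ n, E n) := ge_of_tendsto' hlim fun n =>
    (ENNReal.ofReal_le_ofReal (hge n)).trans_eq (hP.prob_reaches hp 0 n).2.symm
  rw [hzero] at hle
  exact absurd hc (not_lt.2 (ENNReal.ofReal_eq_zero.1 (le_antisymm hle bot_le)))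

theorem summable_reachProb_of_lt_pc {p : ℝ} (hp : 0 ≤ p) (hpc : p < pc d) :
    Summable (reachProb p (0 : V d)) := by
  rw [pc] at hpc
  obtain ⟨p', ⟨hp', h⟩, hpp⟩ := exists_lt_of_lt_csSup (by
    rw [nonempty_iff_ne_empty]
    intro h
    rw [h, Real.sSup_empty] at hpc
    linarith) hpc
  exact summable_reachProb_of_lt hp hpp hp'.2 fun c hc => exists_reachProb_lt hp' h hc

theorem infOpenSurface_of_eventually_not_reaches {ω : Config d} {i j : Fin d} (hij : i ≠ j)
    (h : ∀ᶠ t : ℕ in atTop, ¬ reaches ((t : ℤ) • uv i) t (openEdges ω)) : InfOpenSurface ω := by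
  obtain ⟨N, hN⟩ := eventually_atTop.1 h
  refine infOpenSurface_of_separates (S := {y | ∃ k : ℕ, openConn ω (-(k : ℤ) • uv i) y})
    (fun x ⟨k, hk⟩ y hxy ho => ⟨k, hk.tail ⟨hxy, ho⟩⟩) hij (N := N) (fun t ht => ?_)
    fun t ht ⟨k, hk⟩ => ?_
  · refine ⟨t.natAbs, ?_⟩
    rw [show -(t.natAbs : ℤ) = t by omega]
    exact .refl
  · lift t to ℕ using by omega
    refine hN t (by omega) (reaches_of_joinedIn (joinedIn_of_openConn hk).symm ?_)
    refine le_trans ?_ (natAbs_sub_le_supDist _ _ i)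
    simp [uv]
    omega

theorem ae_infOpenSurface (hd : 2 ≤ d) {p : ℝ} (hp : p ∈ Icc (0 : ℝ) 1) (hpc : p < pc d)
    {P : Measure (Config d)} (hP : IsBernoulli P p) : ∀ᵐ ω ∂P, InfOpenSurface ω := by
  have hsum : ∑' t : ℕ, P {ω | reaches ((t : ℤ) • uv ⟨0, by omega⟩) t (openEdges ω)} ≠ ⊤ := by
    simp_rw [fun t : ℕ => (hP.prob_reaches hp ((t : ℤ) • uv ⟨0, by omega⟩) t).2]
    exact (summable_reachProb_of_lt_pc hp.1 hpc).tsum_ofReal_ne_top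
  filter_upwards [ae_eventually_notMem hsum] with ω hω
  exact infOpenSurface_of_eventually_not_reaches (j := ⟨1, by omega⟩) (by simp) hω

end Measure

/-- For bond percolation on `ℤ^d` (`d ≥ 3`) with `p < p_c`, almost surely
there exists an infinite open surface of dual plaquettes; consequently
`p_surf ≥ p_c`. -/
theorem infinite_open_surface_subcritical (d : ℕ) (hd : 3 ≤ d) (p : ℝ)
    (hp : p ∈ Set.Icc (0 : ℝ) 1) (hppc : p < pc d)
    (P : Measure (Config d)) [IsProbabilityMeasure P] (hP : IsBernoulli P p) :
    P {ω | InfOpenSurface ω} = 1 ∧ pc d ≤ psurf d := by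
  have hmain : ∀ q ∈ Icc (0 : ℝ) 1, q < pc d → ∀ Q : Measure (Config d), IsBernoulli Q q →
      IsProbabilityMeasure Q → Q {ω | InfOpenSurface ω} = 1 := fun q hq hqpc Q hQ _ => by
    rw [measure_congr (eventuallyEq_univ.2 (ae_infOpenSurface (by omega) hq hqpc hQ)),
      measure_univ]
  refine ⟨hmain p hp hppc P hP inferInstance, le_of_forall_lt fun q hq => ?_⟩
  have hpc : pc d ≤ 1 := Real.sSup_le (fun x hx => hx.1.2) zero_le_one
  obtain ⟨r, hr, hrpc⟩ := exists_between (max_lt hq hppc)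
  have hr01 : r ∈ Icc (0 : ℝ) 1 :=
    ⟨hp.1.trans ((le_max_right _ _).trans hr.le), hrpc.le.trans hpc⟩
  refine (lt_of_le_of_lt (le_max_left _ _) hr).trans_le ?_
  refine le_csSup ⟨1, fun x hx => hx.1.2⟩ ⟨hr01, fun Q hQ hprob => ?_⟩
  rw [hmain r hr01 hrpc Q hQ hprob]
  exact one_ne_zero
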